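/- arXiv:1809.08164 — 7 statements merged into one kernel-verified Lean document; each statement's English description precedes it below -/
import Mathlib

section
/- Every four-times differentiable function Q : (-1,1) → ℝ satisfying the linear ODE -(1/2)(1-x²)Q''''(x) + 2x Q'''(x) - 2Q''(x) = 0 for all x ∈ (-1,1) is of the form Q(x) = (C₁/6)x³ + (C₂/8)·x·(-2x + (1-x²)·(log(1-x) - log(1+x))) + C₃ + C₄x for some real constants C₁, C₂, C₃, C₄. -/
lemma const_aux (f : ℝ → ℝ) (h : ∀ x ∈ Set.Ioo (-1 : ℝ) 1, HasDerivAt f 0 x) :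
    ∀ x ∈ Set.Ioo (-1 : ℝ) 1, f x = f 0 := by
  intro x hx
  refine isOpen_Ioo.is_const_of_deriv_eq_zero isPreconnected_Ioo
    (fun y hy => (h y hy).differentiableAt.differentiableWithinAt)
    (fun y hy => (h y hy).deriv) hx (by norm_num)

lemma L_aux (x : ℝ) (hx : x ∈ Set.Ioo (-1 : ℝ) 1) :
    HasDerivAt (fun x => Real.log (1 - x) - Real.log (1 + x)) (-2 / (1 - x^2)) x := by
  have h1 : (1 - x) ≠ 0 := by linarith [hx.2]
  have h2 : (1 + x) ≠ 0 := by linarith [hx.1]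
  have h3 : (1 - x^2) ≠ 0 := by
    have : 1 - x^2 = (1 - x) * (1 + x) := by ring
    rw [this]; exact mul_ne_zero h1 h2
  refine ((((hasDerivAt_id x).const_sub 1).log h1).sub
    (((hasDerivAt_id x).const_add 1).log h2)).congr_deriv ?_
  simp only [id]
  rw [div_sub_div _ _ h1 h2, div_eq_div_iff (mul_ne_zero h1 h2) h3]
  ring

/-- Every four-times differentiable function `Q` on `(-1,1)` satisfying
`-(1/2)(1-x²)Q''''(x) + 2x Q'''(x) - 2Q''(x) = 0` on `(-1,1)` is of the form
`Q(x) = (C₁/6)x³ + (C₂/8)·x·(-2x + (1-x²)(log(1-x) - log(1+x))) + C₃ + C₄x`. -/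
theorem ads2s2_fourth_order_ode_general_solution (Q : ℝ → ℝ)
    (hdiff : ∀ k ≤ 3, ∀ x ∈ Set.Ioo (-1 : ℝ) 1, DifferentiableAt ℝ (iteratedDeriv k Q) x)
    (hODE : ∀ x ∈ Set.Ioo (-1 : ℝ) 1,
      -(1/2) * (1 - x^2) * iteratedDeriv 4 Q x + 2 * x * iteratedDeriv 3 Q x
        - 2 * iteratedDeriv 2 Q x = 0) :
    ∃ C₁ C₂ C₃ C₄ : ℝ, ∀ x ∈ Set.Ioo (-1 : ℝ) 1,
      Q x = C₁ / 6 * x^3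
        + C₂ / 8 * x * (-2 * x + (1 - x^2) * (Real.log (1 - x) - Real.log (1 + x)))
        + C₃ + C₄ * x := by
  have hd : ∀ k ≤ 3, ∀ x ∈ Set.Ioo (-1 : ℝ) 1,
      HasDerivAt (iteratedDeriv k Q) (iteratedDeriv (k+1) Q x) x := by
    intro k hk x hx
    rw [iteratedDeriv_succ]
    exact (hdiff k hk x hx).hasDerivAt
  have d0 := hd 0 (by norm_num)
  have d1 := hd 1 (by norm_num)
  have d2 := hd 2 (by norm_num)
  have d3 := hd 3 (by norm_num)
  simp only [iteratedDeriv_zero, zero_add, Nat.reduceAdd] at d0 d1 d2 d3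
  generalize iteratedDeriv 1 Q = p at *
  generalize iteratedDeriv 2 Q = u at *
  generalize iteratedDeriv 3 Q = v at *
  generalize iteratedDeriv 4 Q = w at *
  clear hd hdiff
  have hs : ∀ x ∈ Set.Ioo (-1 : ℝ) 1, (1 - x^2) ≠ 0 := by
    intro x hx
    nlinarith [mul_pos (sub_pos.2 hx.2) (neg_lt_iff_pos_add.1 hx.1)]
  obtain ⟨L, hL⟩ : ∃ L : ℝ → ℝ, L = fun x => Real.log (1 - x) - Real.log (1 + x) := ⟨_, rfl⟩
  have dL : ∀ x ∈ Set.Ioo (-1 : ℝ) 1, HasDerivAt L (-2 / (1 - x^2)) x := by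
    intro x hx; rw [hL]; exact L_aux x hx
  have hLx : ∀ x, Real.log (1 - x) - Real.log (1 + x) = L x := by intro x; rw [hL]
  simp only [hLx]
  clear hLx hL
  have ds : ∀ x : ℝ, HasDerivAt (fun x : ℝ => 1 - x^2) (-(2 * x)) x := by
    intro x
    simpa using (hasDerivAt_pow 2 x).const_sub 1
  obtain ⟨a, ha⟩ : ∃ a : ℝ, ∀ x ∈ Set.Ioo (-1 : ℝ) 1, (1 - x^2)^2 * (x * v x - u x) = a := by
    refine ⟨_, const_aux (fun x => (1 - x^2)^2 * (x * v x - u x)) ?_⟩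
    intro x hx
    refine (((ds x).pow 2).mul (((hasDerivAt_id' x).mul (d3 x hx)).sub (d2 x hx))).congr_deriv ?_
    simp
    linear_combination (-2 * (1 - x^2) * x) * hODE x hx
  obtain ⟨b, hb⟩ : ∃ b : ℝ, ∀ x ∈ Set.Ioo (-1 : ℝ) 1,
      u x * (-6 * L x * (1 - x^2)^2 + 12 * x * (1 - x^2) + 8 * x)
        - v x * (-12 * (1 - x^2)^2 - 6 * x * L x * (1 - x^2)^2 + 4 * (1 - x^2)) = b := by
    refine ⟨_, const_aux (fun x =>
      u x * (-6 * L x * (1 - x^2)^2 + 12 * x * (1 - x^2) + 8 * x)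
        - v x * (-12 * (1 - x^2)^2 - 6 * x * L x * (1 - x^2)^2 + 4 * (1 - x^2))) ?_⟩
    intro x hx
    have hx' := hasDerivAt_id' x
    have s2 := (ds x).pow 2
    refine (((d2 x hx).mul (((((dL x hx).const_mul (-6)).mul s2).add
      ((hx'.const_mul 12).mul (ds x))).add (hx'.const_mul 8))).sub
      ((d3 x hx).mul (((s2.const_mul (-12)).sub
        (((hx'.const_mul 6).mul (dL x hx)).mul s2)).add ((ds x).const_mul 4)))).congr_deriv ?_
    have h := hs x hx
    have hr : (-2 / (1 - x^2)) * (1 - x^2) = -2 := div_mul_cancel₀ _ h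
    generalize -2 / (1 - x^2) = r at *
    simp
    linear_combination (2 * (-12 * (1 - x^2) - 6 * x * L x * (1 - x^2) + 4)) * hODE x hx
      + (-6 * u x * (1 - x^2) + 6 * x * v x * (1 - x^2)) * hr
  have hu : ∀ x ∈ Set.Ioo (-1 : ℝ) 1,
      u x = b / 8 * x + a / 8 * (-12 - 6 * x * L x + 4 / (1 - x^2)) := by
    intro x hx
    have h := hs x hx
    rw [← ha x hx, ← hb x hx]
    field_simp
    ring
  obtain ⟨c, hc⟩ : ∃ c : ℝ, ∀ x ∈ Set.Ioo (-1 : ℝ) 1,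
      p x - (b / 16 * x^2 + a / 8 * (-6 * x + (1 - 3 * x^2) * L x)) = c := by
    refine ⟨_, const_aux (fun x =>
      p x - (b / 16 * x^2 + a / 8 * (-6 * x + (1 - 3 * x^2) * L x))) ?_⟩
    intro x hx
    have hx' := hasDerivAt_id' x
    refine ((d1 x hx).sub (((hasDerivAt_pow 2 x).const_mul (b / 16)).add
      (((hx'.const_mul (-6)).add ((((hasDerivAt_pow 2 x).const_mul 3).const_sub 1).mul
        (dL x hx))).const_mul (a / 8)))).congr_deriv ?_
    have h := hs x hx
    rw [hu x hx]
    simp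
    field_simp
    ring
  obtain ⟨d, hd⟩ : ∃ d : ℝ, ∀ x ∈ Set.Ioo (-1 : ℝ) 1,
      Q x - (b / 48 * x^3 + a / 8 * (x * (-2 * x + (1 - x^2) * L x)) + c * x) = d := by
    refine ⟨_, const_aux (fun x =>
      Q x - (b / 48 * x^3 + a / 8 * (x * (-2 * x + (1 - x^2) * L x)) + c * x)) ?_⟩
    intro x hx
    have hx' := hasDerivAt_id' x
    refine ((d0 x hx).sub ((((hasDerivAt_pow 3 x).const_mul (b / 48)).add
      ((hx'.mul ((hx'.const_mul (-2)).add ((ds x).mul (dL x hx)))).const_mul (a / 8))).add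
      (hx'.const_mul c))).congr_deriv ?_
    have h := hs x hx
    rw [← hc x hx]
    simp
    field_simp
    ring
  refine ⟨b / 8, a, d, c, fun x hx => ?_⟩
  linear_combination hd x hx
end

section
/- Every twice continuously differentiable function Q : (-1,1) → ℝ satisfying (1-x²)Q''(x) + 2Q(x) = 0 for all x ∈ (-1,1) and having bounded first derivative on (-1,1) is of the form Q(x) = K(1-x²) for some real constant K. -/
/-- Every C² function `Q` on `(-1,1)` with `(1-x²)Q'' + 2Q = 0` and
bounded first derivative is `Q(x) = K(1-x²)` for some constant `K`. -/
theorem legendre_type_ode_regular_solution (Q : ℝ → ℝ)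
    (hQdiff : ∀ k ≤ 1, ∀ x ∈ Set.Ioo (-1 : ℝ) 1, DifferentiableAt ℝ (iteratedDeriv k Q) x)
    (hQcont : ContinuousOn (iteratedDeriv 2 Q) (Set.Ioo (-1 : ℝ) 1))
    (hODE : ∀ x ∈ Set.Ioo (-1 : ℝ) 1, (1 - x^2) * iteratedDeriv 2 Q x + 2 * Q x = 0)
    (hbdd : ∃ M : ℝ, ∀ x ∈ Set.Ioo (-1 : ℝ) 1, |deriv Q x| ≤ M) :
    ∃ K : ℝ, ∀ x ∈ Set.Ioo (-1 : ℝ) 1, Q x = K * (1 - x^2) := by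
  obtain ⟨M, hM⟩ := hbdd
  have h1 : ∀ x ∈ Set.Ioo (-1 : ℝ) 1, HasDerivAt Q (deriv Q x) x := by
    intro x hx
    have := hQdiff 0 (by norm_num) x hx
    rw [iteratedDeriv_zero] at this
    exact this.hasDerivAt
  have h2 : ∀ x ∈ Set.Ioo (-1 : ℝ) 1, HasDerivAt (deriv Q) (iteratedDeriv 2 Q x) x := by
    intro x hx
    have := (hQdiff 1 (by norm_num) x hx).hasDerivAt
    rw [← iteratedDeriv_succ, iteratedDeriv_one] at this
    exact this
  have key : ∀ f : ℝ → ℝ, (∀ x ∈ Set.Ioo (-1 : ℝ) 1, HasDerivAt f 0 x) →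
      ∀ x ∈ Set.Ioo (-1 : ℝ) 1, f x = f 0 := by
    intro f hf x hx
    refine isOpen_Ioo.is_const_of_deriv_eq_zero isPreconnected_Ioo
      (fun y hy => (hf y hy).differentiableAt.differentiableWithinAt)
      (fun y hy => (hf y hy).deriv) hx (by norm_num)
  let L : ℝ → ℝ := fun x => Real.log (1 + x) - Real.log (1 - x)
  have hL : ∀ x ∈ Set.Ioo (-1 : ℝ) 1, HasDerivAt L (1 / (1 + x) + 1 / (1 - x)) x := by
    intro x hx
    have a := ((hasDerivAt_id x).const_add 1).log (by simp; linarith [hx.1])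
    have b := ((hasDerivAt_id x).const_sub 1).log (by simp; linarith [hx.2])
    refine (a.sub b).congr_deriv ?_
    simp only [id]
    ring
  let S : ℝ → ℝ := fun x => x / 2 + (1 - x ^ 2) * L x / 4
  let T : ℝ → ℝ := fun x => 1 - x * L x / 2
  have hsq : ∀ x : ℝ, HasDerivAt (fun y : ℝ => 1 - y ^ 2) (-(2 * x)) x := by
    intro x
    have := (hasDerivAt_pow 2 x).const_sub 1
    refine this.congr_deriv ?_
    simp
  have hS : ∀ x ∈ Set.Ioo (-1 : ℝ) 1, HasDerivAt S (T x) x := by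
    intro x hx
    have := ((hasDerivAt_id x).div_const 2).add (((hsq x).mul (hL x hx)).div_const 4)
    refine this.congr_deriv ?_
    have : 1 + x ≠ 0 := by linarith [hx.1]
    have : 1 - x ≠ 0 := by linarith [hx.2]
    simp only [T]
    field_simp
    ring
  have hT : ∀ x ∈ Set.Ioo (-1 : ℝ) 1, HasDerivAt T (- (L x / 2) - x / (1 - x ^ 2)) x := by
    intro x hx
    have := (((hasDerivAt_id x).mul (hL x hx)).div_const 2).const_sub 1
    refine this.congr_deriv ?_
    have : 1 + x ≠ 0 := by linarith [hx.1]
    have : 1 - x ≠ 0 := by linarith [hx.2]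
    have e : 1 - x ^ 2 = (1 + x) * (1 - x) := by ring
    rw [e]
    simp only [id]
    field_simp
    ring
  have hc := key (fun x => (1 - x ^ 2) * deriv Q x + 2 * x * Q x) (by
    intro x hx
    have := ((hsq x).mul (h2 x hx)).add (((hasDerivAt_id x).const_mul 2).mul (h1 x hx))
    refine this.congr_deriv ?_
    simp only [id]
    linear_combination hODE x hx)
  have hK := key (fun x => Q x * T x - deriv Q x * S x) (by
    intro x hx
    have := ((h1 x hx).mul (hT x hx)).sub ((h2 x hx).mul (hS x hx))
    refine this.congr_deriv ?_
    have hp : 1 - x ^ 2 ≠ 0 := by nlinarith [hx.1, hx.2]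
    have e : iteratedDeriv 2 Q x = - (2 * Q x) / (1 - x ^ 2) := by
      field_simp
      linear_combination hODE x hx
    rw [e]
    simp only [S]
    field_simp
    ring)
  obtain ⟨c, hc⟩ : ∃ c, ∀ x ∈ Set.Ioo (-1 : ℝ) 1,
      (1 - x ^ 2) * deriv Q x + 2 * x * Q x = c := ⟨_, hc⟩
  obtain ⟨K, hK⟩ : ∃ K, ∀ x ∈ Set.Ioo (-1 : ℝ) 1,
      Q x * T x - deriv Q x * S x = K := ⟨_, hK⟩
  have hW : ∀ x, (1 - x ^ 2) * T x + 2 * x * S x = 1 := by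
    intro x
    simp only [S, T]
    ring
  have hQ' : ∀ x ∈ Set.Ioo (-1 : ℝ) 1, deriv Q x = c * T x - 2 * x * K := by
    intro x hx
    rw [← hc x hx, ← hK x hx]
    linear_combination (-deriv Q x) * hW x
  have hQ : ∀ x ∈ Set.Ioo (-1 : ℝ) 1, Q x = c * S x + K * (1 - x ^ 2) := by
    intro x hx
    rw [← hc x hx, ← hK x hx]
    linear_combination (-Q x) * hW x
  have c0 : c = 0 := by
    by_contra hne
    have hcp : 0 < |c| := abs_pos.mpr hne
    have hM0 : 0 ≤ M := (abs_nonneg _).trans (hM 0 (by norm_num))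
    set t : ℝ := 4 * (1 + (M + 2 * |K| + 1) / |c|) with ht
    have hr : 0 ≤ (M + 2 * |K| + 1) / |c| := by positivity
    have ht1 : 1 ≤ t := by linarith
    have hep := Real.exp_pos (-t)
    have he : Real.exp (-t) ≤ 1 / 2 := by
      have h3 := Real.add_one_le_exp t
      rw [Real.exp_neg, ← one_div]
      exact one_div_le_one_div_of_le (by norm_num) (by linarith)
    have hx : 1 - Real.exp (-t) ∈ Set.Ioo (-1 : ℝ) 1 := ⟨by linarith, by linarith⟩
    have hLt : t ≤ L (1 - Real.exp (-t)) := by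
      simp only [L, sub_sub_cancel, Real.log_exp]
      have := Real.log_nonneg (x := 1 + (1 - Real.exp (-t))) (by linarith)
      linarith
    have hb := hM _ hx
    rw [hQ' _ hx] at hb
    have hxh : 1 / 2 ≤ 1 - Real.exp (-t) := by linarith
    generalize 1 - Real.exp (-t) = x at hx hLt hb hxh
    have hT1 : (M + 2 * |K| + 1) / |c| ≤ - T x := by
      simp only [T]
      nlinarith
    have hT2 : M + 2 * |K| + 1 ≤ |c| * |T x| := by
      rw [div_le_iff₀ hcp] at hT1
      nlinarith [neg_le_abs (T x)]
    have h3 : |c * T x| ≤ |c * T x - 2 * x * K| + |2 * x * K| := by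
      have := abs_add_le (c * T x - 2 * x * K) (2 * x * K)
      simpa using this
    have h4 : |2 * x * K| ≤ 2 * |K| := by
      rw [abs_mul]
      have : |2 * x| ≤ 2 := abs_le.mpr ⟨by linarith [hx.1], by linarith [hx.2]⟩
      exact mul_le_mul_of_nonneg_right this (abs_nonneg _)
    rw [abs_mul] at h3
    linarith
  refine ⟨K, fun x hx => ?_⟩
  rw [hQ x hx, c0]
  ring
end

section
/- Fix a real constant K. Every twice continuously differentiable function Q : (-1,1) → ℝ satisfying the first-order linear ODE x(1-x²)Q'(x) = 2(1-3x²)Q(x) + 2K(1-x²)³ for all x ∈ (-1,1) is of the form Q(x) = -K(1-x²)² + C·x²(1-x²)² for some real constant C. -/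
theorem aux_const (K : ℝ) (Q : ℝ → ℝ) (a b : ℝ) (hs : ∀ x ∈ Set.Ioo a b, x ∈ Set.Ioo (-1:ℝ) 1 ∧ x ≠ 0)
    (hab : a < b)
    (hd : ∀ x ∈ Set.Ioo (-1 : ℝ) 1, DifferentiableAt ℝ Q x)
    (hODE : ∀ x ∈ Set.Ioo (-1 : ℝ) 1,
      x * (1 - x^2) * deriv Q x = 2 * (1 - 3 * x^2) * Q x + 2 * K * (1 - x^2)^3) :
    ∃ C : ℝ, ∀ x ∈ Set.Ioo a b, Q x = -K * (1 - x^2)^2 + C * x^2 * (1 - x^2)^2 := by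
  have hne : ∀ x ∈ Set.Ioo a b, x ≠ 0 ∧ 1 - x^2 ≠ 0 := by
    intro x hx
    obtain ⟨⟨h1, h2⟩, h0⟩ := hs x hx
    exact ⟨h0, by nlinarith⟩
  have hder : ∀ x ∈ Set.Ioo a b,
      HasDerivAt (fun x => (Q x + K * (1 - x^2)^2) / (x^2 * (1 - x^2)^2)) 0 x := by
    intro x hx
    obtain ⟨h0, h1⟩ := hne x hx
    have e := hODE x (hs x hx).1
    have hp : HasDerivAt (fun x : ℝ => 1 - x^2) (-(2*x)) x := by
      simpa using (hasDerivAt_pow 2 x).const_sub 1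
    have hp2 : HasDerivAt (fun x : ℝ => (1 - x^2)^2) (2 * (1 - x^2) * (-(2*x))) x := by
      simpa using hp.fun_pow 2
    have hx2 : HasDerivAt (fun x : ℝ => x^2) (2*x) x := by simpa using hasDerivAt_pow 2 x
    have hn := (hd x (hs x hx).1).hasDerivAt.fun_add (hp2.const_mul K)
    have hq := hn.fun_div (hx2.fun_mul hp2) (by positivity)
    refine hq.congr_deriv ?_
    rw [div_eq_zero_iff]
    left
    linear_combination (x * (1 - x^2)) * e
  refine ⟨(fun x => (Q x + K * (1 - x^2)^2) / (x^2 * (1 - x^2)^2)) ((a+b)/2), fun x hx => ?_⟩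
  have hc := isOpen_Ioo.is_const_of_deriv_eq_zero (isPreconnected_Ioo)
    (fun y hy => (hder y hy).differentiableAt.differentiableWithinAt)
    (fun y hy => (hder y hy).deriv) hx (show (a+b)/2 ∈ Set.Ioo a b by constructor <;> linarith)
  beta_reduce
  rw [← hc]
  obtain ⟨h0, h1⟩ := hne x hx
  field_simp
  ring

theorem aux_deriv (K C : ℝ) (Q : ℝ → ℝ) (x : ℝ) (hx : x ∈ Set.Ioo (-1:ℝ) 1) (h0 : x ≠ 0)
    (hODE : x * (1 - x^2) * deriv Q x = 2 * (1 - 3 * x^2) * Q x + 2 * K * (1 - x^2)^3)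
    (h : Q x = -K * (1 - x^2)^2 + C * x^2 * (1 - x^2)^2) :
    deriv Q x = x * ((1 - x^2) * (4 * K + 2 * C * (1 - 3 * x^2))) := by
  have h1 : 1 - x^2 ≠ 0 := by obtain ⟨h1, h2⟩ := hx; nlinarith
  have : x * (1 - x^2) ≠ 0 := mul_ne_zero h0 h1
  apply mul_left_cancel₀ this
  rw [hODE, h]; ring

theorem aux_side (K C : ℝ) (g : ℝ → ℝ) (s : Set ℝ) (hg : DifferentiableAt ℝ g 0)
    (hs : (nhdsWithin (0:ℝ) s).NeBot) (hs0 : (0:ℝ) ∉ s)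
    (h : ∀ᶠ x in nhdsWithin (0:ℝ) s, g x = x * ((1 - x^2) * (4 * K + 2 * C * (1 - 3 * x^2)))) :
    deriv g 0 = 4 * K + 2 * C := by
  have hp : Continuous (fun x : ℝ => (1 - x^2) * (4 * K + 2 * C * (1 - 3 * x^2))) := by fun_prop
  have hp' : Continuous (fun x : ℝ => x * ((1 - x^2) * (4 * K + 2 * C * (1 - 3 * x^2)))) := by
    fun_prop
  have hg0 : g 0 = 0 := by
    have t1 : Filter.Tendsto g (nhdsWithin 0 s) (nhds (g 0)) :=
      hg.continuousAt.tendsto.mono_left nhdsWithin_le_nhds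
    have t2 := (hp'.tendsto 0).mono_left (nhdsWithin_le_nhds (s := s))
    have := tendsto_nhds_unique t1 (t2.congr' (h.mono fun x hx => hx.symm))
    simpa using this
  have t1 := (hasDerivWithinAt_iff_tendsto_slope' hs0).1 (hg.hasDerivAt.hasDerivWithinAt (s := s))
  have t2 := (hp.tendsto 0).mono_left (nhdsWithin_le_nhds (s := s))
  have t3 : Filter.Tendsto (slope g 0) (nhdsWithin 0 s) _ := t2.congr' (by
    filter_upwards [h, self_mem_nhdsWithin] with x hx hxs
    have : x ≠ 0 := fun e => hs0 (e ▸ hxs)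
    rw [slope_def_field, hg0, hx]
    field_simp
    ring)
  have := tendsto_nhds_unique t1 t3
  simpa using this

/-- For a fixed constant `K`, every C² function `Q` on `(-1,1)` satisfying
`x(1-x²)Q'(x) = 2(1-3x²)Q(x) + 2K(1-x²)³` is of the form
`Q(x) = -K(1-x²)² + C x²(1-x²)²` for some constant `C`. -/
theorem first_order_singular_ode_general_solution (K : ℝ) (Q : ℝ → ℝ)
    (hQdiff : ∀ k ≤ 1, ∀ x ∈ Set.Ioo (-1 : ℝ) 1, DifferentiableAt ℝ (iteratedDeriv k Q) x)
    (hQcont : ContinuousOn (iteratedDeriv 2 Q) (Set.Ioo (-1 : ℝ) 1))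
    (hODE : ∀ x ∈ Set.Ioo (-1 : ℝ) 1,
      x * (1 - x^2) * deriv Q x = 2 * (1 - 3 * x^2) * Q x + 2 * K * (1 - x^2)^3) :
    ∃ C : ℝ, ∀ x ∈ Set.Ioo (-1 : ℝ) 1,
      Q x = -K * (1 - x^2)^2 + C * x^2 * (1 - x^2)^2 := by
  have hd : ∀ x ∈ Set.Ioo (-1 : ℝ) 1, DifferentiableAt ℝ Q x := by
    intro x hx
    simpa using hQdiff 0 (by norm_num) x hx
  have hd1 : DifferentiableAt ℝ (deriv Q) 0 := by
    simpa using hQdiff 1 le_rfl 0 (by norm_num)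
  obtain ⟨C, hC⟩ := aux_const K Q 0 1
    (fun x hx => ⟨⟨by linarith [hx.1], hx.2⟩, hx.1.ne'⟩) (by norm_num) hd hODE
  obtain ⟨D, hD⟩ := aux_const K Q (-1) 0
    (fun x hx => ⟨⟨hx.1, by linarith [hx.2]⟩, hx.2.ne⟩) (by norm_num) hd hODE
  have e1 := aux_side K C (deriv Q) (Set.Ioi 0) hd1 inferInstance (by simp) (by
    filter_upwards [Ioo_mem_nhdsGT (show (0:ℝ) < 1 by norm_num)] with x hx
    have hm : x ∈ Set.Ioo (-1:ℝ) 1 := ⟨by linarith [hx.1], hx.2⟩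
    exact aux_deriv K C Q x hm hx.1.ne' (hODE x hm) (hC x hx))
  have e2 := aux_side K D (deriv Q) (Set.Iio 0) hd1 inferInstance (by simp) (by
    filter_upwards [Ioo_mem_nhdsLT (show (-1:ℝ) < 0 by norm_num)] with x hx
    have hm : x ∈ Set.Ioo (-1:ℝ) 1 := ⟨hx.1, by linarith [hx.2]⟩
    exact aux_deriv K D Q x hm hx.2.ne (hODE x hm) (hD x hx))
  have hCD : D = C := by linarith
  subst hCD
  refine ⟨D, fun x hx => ?_⟩
  rcases lt_trichotomy x 0 with h | h | h
  · exact hD x ⟨hx.1, h⟩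
  · subst h
    have := hODE 0 hx
    norm_num at this ⊢
    linarith
  · exact hC x ⟨h, hx.2⟩
end

section
/- Let q_e, q_m be real constants with q_e² + q_m² > 0, and let γ, Q₁, Q₂, Q₃ : (-1,1) → ℝ be functions each of which extends to a C^∞ function on [-1,1]. Suppose that for all x ∈ (-1,1): (i) 2q_m x³(1-x²)·E(x) - q_e·F(x) = 0; (ii) 2q_e x³(1-x²)·E(x) + q_m·F(x) = 0; (iii) (1-x²)·((1-x²)γ)'' + 2x·((1-x²)γ)' + 2(1-x²)γ + 4(1-x²)Q₁' + 8xQ₁ = 0; and (iv) -x(1-x²)Q₂' + 2(1-3x²)Q₂ - 2x(1-x²)²Q₃' + 2(1-x²)(1-3x²)Q₃ = 0, where E(x) := ((1-x²)γ)' - (1-x²)Q₁'' + 2Q₁ and F(x) := x(1-x²)²(-xQ₃'' + 2Q₃') + 2(1-x²)(2x²-1)Q₃ + x(1-x²)Q₂' + 2(3x²-1)Q₂. Then there exist real constants K₁, K₂, K₃ such that Q₁(x) = K₁x(1-x²), γ(x) = 2K₁(1-x²), Q₃(x) = K₂(1-x²), and Q₂(x) = -K₂(1-x²)² + K₃x²(1-x²)²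 for all x ∈ (-1,1). -/
/-- The gauge-invariant combination `E(x) = ((1-x²)γ)' - (1-x²)Q₁'' + 2Q₁`. -/
noncomputable def Efun (γ Q₁ : ℝ → ℝ) (x : ℝ) : ℝ :=
  deriv (fun y => (1 - y^2) * γ y) x - (1 - x^2) * iteratedDeriv 2 Q₁ x + 2 * Q₁ x

/-- The gauge-invariant combination
`F(x) = x(1-x²)²(-xQ₃'' + 2Q₃') + 2(1-x²)(2x²-1)Q₃ + x(1-x²)Q₂' + 2(3x²-1)Q₂`. -/
noncomputable def Ffun (Q₂ Q₃ : ℝ → ℝ) (x : ℝ) : ℝ :=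
  x * (1 - x^2)^2 * (-(x * iteratedDeriv 2 Q₃ x) + 2 * deriv Q₃ x)
    + 2 * (1 - x^2) * (2 * x^2 - 1) * Q₃ x
    + x * (1 - x^2) * deriv Q₂ x + 2 * (3 * x^2 - 1) * Q₂ x

theorem aux_D {f : ℝ → ℝ} (hf : ContDiffOn ℝ (⊤ : ℕ∞) f (Set.Icc (-1 : ℝ) 1)) :
    ∃ f' : ℝ → ℝ, ContDiffOn ℝ (⊤ : ℕ∞) f' (Set.Icc (-1 : ℝ) 1) ∧
      ∀ x ∈ Set.Ioo (-1 : ℝ) 1, HasDerivAt f (f' x) x := by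
  have hu : UniqueDiffOn ℝ (Set.Icc (-1 : ℝ) 1) := uniqueDiffOn_Icc (by norm_num)
  refine ⟨derivWithin f (Set.Icc (-1 : ℝ) 1), hf.derivWithin hu (by simp), ?_⟩
  intro x hx
  have h1 : DifferentiableWithinAt ℝ f (Set.Icc (-1 : ℝ) 1) x :=
    (hf.differentiableOn (by simp)) x (Set.Ioo_subset_Icc_self hx)
  exact h1.hasDerivWithinAt.hasDerivAt (Icc_mem_nhds hx.1 hx.2)

theorem aux_Do {f : ℝ → ℝ} (hf : ContDiffOn ℝ (⊤ : ℕ∞) f (Set.Ioo (-1 : ℝ) 1)) :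
    ∃ f' : ℝ → ℝ, ContDiffOn ℝ (⊤ : ℕ∞) f' (Set.Ioo (-1 : ℝ) 1) ∧
      ∀ x ∈ Set.Ioo (-1 : ℝ) 1, HasDerivAt f (f' x) x := by
  have hu : UniqueDiffOn ℝ (Set.Ioo (-1 : ℝ) 1) := uniqueDiffOn_Ioo _ _
  refine ⟨derivWithin f (Set.Ioo (-1 : ℝ) 1), hf.derivWithin hu (by simp), ?_⟩
  intro x hx
  have h1 : DifferentiableWithinAt ℝ f (Set.Ioo (-1 : ℝ) 1) x :=
    (hf.differentiableOn (by simp)) x hx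
  exact h1.hasDerivWithinAt.hasDerivAt (Ioo_mem_nhds hx.1 hx.2)

theorem aux_deriv2 {f f' f'' : ℝ → ℝ}
    (h1 : ∀ x ∈ Set.Ioo (-1 : ℝ) 1, HasDerivAt f (f' x) x)
    (h2 : ∀ x ∈ Set.Ioo (-1 : ℝ) 1, HasDerivAt f' (f'' x) x) :
    ∀ x ∈ Set.Ioo (-1 : ℝ) 1, iteratedDeriv 2 f x = f'' x := by
  intro x hx
  rw [iteratedDeriv_succ, iteratedDeriv_one]
  have : deriv f =ᶠ[nhds x] f' := by
    filter_upwards [Ioo_mem_nhds hx.1 hx.2] with y hy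
    exact (h1 y hy).deriv
  rw [this.deriv_eq]
  exact (h2 x hx).deriv

theorem aux_Z {g : ℝ → ℝ} (hg : ∀ x ∈ Set.Ioo (-1 : ℝ) 1, g x = 0) {x d : ℝ}
    (hx : x ∈ Set.Ioo (-1 : ℝ) 1) (h : HasDerivAt g d x) : d = 0 := by
  have : g =ᶠ[nhds x] fun _ => 0 := by
    filter_upwards [Ioo_mem_nhds hx.1 hx.2] with y hy
    exact hg y hy
  have h2 := this.deriv_eq
  rw [h.deriv] at h2
  simpa using h2

theorem aux_C {g : ℝ → ℝ} (hg : ∀ x ∈ Set.Ioo (-1 : ℝ) 1, HasDerivAt g 0 x) :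
    ∀ x ∈ Set.Ioo (-1 : ℝ) 1, g x = g 0 := by
  intro x hx
  refine isOpen_Ioo.is_const_of_deriv_eq_zero isPreconnected_Ioo (𝕜 := ℝ)
    (s := Set.Ioo (-1 : ℝ) 1) (fun y hy => (hg y hy).differentiableAt.differentiableWithinAt)
    (fun y hy => (hg y hy).deriv) hx (by norm_num)

theorem aux_ext {g : ℝ → ℝ} (hc : ContinuousOn g (Set.Icc (-1 : ℝ) 1))
    (h0 : ∀ x ∈ Set.Ioo (-1 : ℝ) 1, x ≠ 0 → g x = 0) :
    ∀ x ∈ Set.Icc (-1 : ℝ) 1, g x = 0 := by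
  have hs : Set.EqOn g (fun _ => 0) (Set.Ioo (-1 : ℝ) 0 ∪ Set.Ioo 0 1) := by
    rintro x (hx | hx)
    · exact h0 x ⟨hx.1, by linarith [hx.2]⟩ hx.2.ne
    · exact h0 x ⟨by linarith [hx.1], hx.2⟩ hx.1.ne'
  refine hs.of_subset_closure hc continuousOn_const ?_ ?_
  · rintro x (hx | hx)
    · exact ⟨hx.1.le, by linarith [hx.2]⟩
    · exact ⟨by linarith [hx.1], hx.2.le⟩
  · rw [closure_union, closure_Ioo (by norm_num), closure_Ioo (by norm_num)]
    intro x hx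
    rcases le_total x 0 with h | h
    · exact Or.inl ⟨hx.1, h⟩
    · exact Or.inr ⟨h, hx.2⟩

theorem aux_p (x : ℝ) : HasDerivAt (fun y : ℝ => 1 - y ^ 2) (-2 * x) x := by
  have := ((hasDerivAt_id x).pow 2).const_sub 1
  refine this.congr_deriv ?_
  simp

theorem aux_pos {x : ℝ} (hx : x ∈ Set.Ioo (-1 : ℝ) 1) : 0 < 1 - x ^ 2 := by
  nlinarith [hx.1, hx.2]

theorem aux_Q3 {Q : ℝ → ℝ} {Q' Q'' : ℝ → ℝ}
    (c0 : ContinuousOn Q (Set.Icc (-1 : ℝ) 1))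
    (c1 : ContinuousOn Q' (Set.Icc (-1 : ℝ) 1))
    (c2 : ContinuousOn Q'' (Set.Icc (-1 : ℝ) 1))
    (h1 : ∀ x ∈ Set.Ioo (-1 : ℝ) 1, HasDerivAt Q (Q' x) x)
    (h2 : ∀ x ∈ Set.Ioo (-1 : ℝ) 1, HasDerivAt Q' (Q'' x) x)
    (h : ∀ x ∈ Set.Ioo (-1 : ℝ) 1, x ≠ 0 → (1 - x ^ 2) * Q'' x + 2 * Q x = 0) :
    ∃ K : ℝ, ∀ x ∈ Set.Ioo (-1 : ℝ) 1, Q x = K * (1 - x ^ 2) := by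
  have hE := aux_ext (g := fun x => (1 - x ^ 2) * Q'' x + 2 * Q x) (by fun_prop) h
  have hQ1 : Q 1 = 0 := by
    have := hE 1 (by norm_num)
    norm_num at this
    exact this
  have hW : ∀ x ∈ Set.Ioo (-1 : ℝ) 1,
      HasDerivAt (fun y => Q' y * (1 - y ^ 2) + 2 * y * Q y) 0 x := by
    intro x hx
    refine (((h2 x hx).mul (aux_p x)).add
      (((hasDerivAt_id x).const_mul 2).mul (h1 x hx))).congr_deriv ?_
    have := hE x (Set.Ioo_subset_Icc_self hx)
    simp only [id] at this ⊢
    linarith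
  have hWc := aux_C hW
  have hW2 := aux_ext (g := fun y => Q' y * (1 - y ^ 2) + 2 * y * Q y
    - (Q' 0 * (1 - 0 ^ 2) + 2 * 0 * Q 0)) (by fun_prop)
    (fun x hx _ => sub_eq_zero.2 (hWc x hx))
  have hW1 := hW2 1 (by norm_num)
  simp only [hQ1] at hW1
  refine ⟨Q 0 / (1 - 0 ^ 2), ?_⟩
  have hR : ∀ x ∈ Set.Ioo (-1 : ℝ) 1, HasDerivAt (fun y => Q y / (1 - y ^ 2)) 0 x := by
    intro x hx
    have hp := aux_pos hx
    refine ((h1 x hx).div (aux_p x) hp.ne').congr_deriv ?_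
    have := hW2 x (Set.Ioo_subset_Icc_self hx)
    rw [div_eq_zero_iff]; left
    linarith
  intro x hx
  rw [← aux_C hR x hx, div_mul_cancel₀ _ (aux_pos hx).ne']

theorem aux_Q2 {R : ℝ → ℝ} (hR : ContDiffOn ℝ (⊤ : ℕ∞) R (Set.Ioo (-1 : ℝ) 1))
    (h : ∀ x ∈ Set.Ioo (-1 : ℝ) 1, ∀ d, HasDerivAt R d x → x * d = 2 * R x) :
    ∃ K : ℝ, ∀ x ∈ Set.Ioo (-1 : ℝ) 1, R x = K * x ^ 2 := by
  obtain ⟨R1, hR1, d1⟩ := aux_Do hR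
  obtain ⟨R2, hR2, d2⟩ := aux_Do hR1
  obtain ⟨R3, hR3, d3⟩ := aux_Do hR2
  have e1 : ∀ x ∈ Set.Ioo (-1 : ℝ) 1, x * R1 x - 2 * R x = 0 :=
    fun x hx => sub_eq_zero.2 (h x hx _ (d1 x hx))
  have e2 : ∀ x ∈ Set.Ioo (-1 : ℝ) 1, x * R2 x - R1 x = 0 := by
    intro x hx
    have := aux_Z e1 hx (((hasDerivAt_id x).mul (d2 x hx)).sub ((d1 x hx).const_mul 2))
    simp only [id] at this
    linarith
  have e3 : ∀ x ∈ Set.Ioo (-1 : ℝ) 1, x * R3 x = 0 := by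
    intro x hx
    have := aux_Z e2 hx (((hasDerivAt_id x).mul (d3 x hx)).sub (d2 x hx))
    simp only [id] at this
    linarith
  have e4 : ∀ x ∈ Set.Ioo (-1 : ℝ) 1, R3 x = 0 := by
    have hz : ∀ x ∈ Set.Ioo (-1 : ℝ) 1, x ≠ 0 → R3 x = 0 := fun x hx h0 =>
      (mul_eq_zero.1 (e3 x hx)).resolve_left h0
    intro x hx
    by_cases h0 : x = 0
    · subst h0
      have hc : ContinuousAt R3 0 := hR3.continuousOn.continuousAt (Ioo_mem_nhds hx.1 hx.2)
      have ht := hc.tendsto.mono_left (nhdsWithin_le_nhds (s := {0}ᶜ))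
      refine tendsto_nhds_unique ht ((tendsto_const_nhds (x := (0:ℝ))).congr' ?_)
      filter_upwards [self_mem_nhdsWithin, mem_nhdsWithin_of_mem_nhds (Ioo_mem_nhds hx.1 hx.2)]
        with y hy hy2
      exact (hz y hy2 hy).symm
    · exact hz x hx h0
  have e5 := aux_C (g := R2) (fun x hx => by have := d3 x hx; rwa [e4 x hx] at this)
  refine ⟨R2 0 / 2, fun x hx => ?_⟩
  have a := e1 x hx
  have b := e2 x hx
  rw [e5 x hx] at b
  linear_combination (-1/2) * a - x / 2 * b

theorem aux_v {v v' v'' : ℝ → ℝ}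
    (s0 : ContDiffOn ℝ (⊤ : ℕ∞) v (Set.Icc (-1 : ℝ) 1))
    (c1 : ContinuousOn v' (Set.Icc (-1 : ℝ) 1))
    (c2 : ContinuousOn v'' (Set.Icc (-1 : ℝ) 1))
    (h1 : ∀ x ∈ Set.Ioo (-1 : ℝ) 1, HasDerivAt v (v' x) x)
    (h2 : ∀ x ∈ Set.Ioo (-1 : ℝ) 1, HasDerivAt v' (v'' x) x)
    (h : ∀ x ∈ Set.Ioo (-1 : ℝ) 1, (1 - x ^ 2) * v'' x + 6 * v x = 0) :
    ∃ K : ℝ, ∀ x ∈ Set.Ioo (-1 : ℝ) 1, v x = K * x * (1 - x ^ 2) := by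
  have c0 := s0.continuousOn
  have hE := aux_ext (g := fun x => (1 - x ^ 2) * v'' x + 6 * v x) (by fun_prop)
    (fun x hx _ => h x hx)
  have hv1 : v 1 = 0 := by
    have := hE 1 (by norm_num)
    norm_num at this
    exact this
  have hp3 : ∀ x : ℝ, HasDerivAt (fun y : ℝ => y * (1 - y ^ 2)) (1 - 3 * x ^ 2) x := by
    intro x
    refine ((hasDerivAt_id x).mul (aux_p x)).congr_deriv ?_
    simp only [id]; ring
  have hp4 : ∀ x : ℝ, HasDerivAt (fun y : ℝ => 1 - 3 * y ^ 2) (- 6 * x) x := by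
    intro x
    refine ((((hasDerivAt_id x).pow 2).const_mul 3).const_sub 1).congr_deriv ?_
    simp; ring
  have hW : ∀ x ∈ Set.Ioo (-1 : ℝ) 1,
      HasDerivAt (fun y => v' y * (y * (1 - y ^ 2)) - v y * (1 - 3 * y ^ 2)) 0 x := by
    intro x hx
    refine (((h2 x hx).mul (hp3 x)).sub ((h1 x hx).mul (hp4 x))).congr_deriv ?_
    linear_combination x * h x hx
  have hWc := aux_C hW
  have hW2 := aux_ext (g := fun y => v' y * (y * (1 - y ^ 2)) - v y * (1 - 3 * y ^ 2)
    - (v' 0 * (0 * (1 - 0 ^ 2)) - v 0 * (1 - 3 * 0 ^ 2))) (by fun_prop)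
    (fun x hx _ => sub_eq_zero.2 (hWc x hx))
  have hW1 := hW2 1 (by norm_num)
  simp only [hv1] at hW1
  have hs : ContDiffOn ℝ (⊤ : ℕ∞) (fun x => x * (v x / (1 - x ^ 2))) (Set.Ioo (-1 : ℝ) 1) := by
    refine contDiffOn_id.mul ((s0.mono Set.Ioo_subset_Icc_self).div (by fun_prop) ?_)
    exact fun x hx => (aux_pos hx).ne'
  have hd : ∀ x ∈ Set.Ioo (-1 : ℝ) 1, HasDerivAt (fun x => v x / (1 - x ^ 2))
      ((v' x * (1 - x ^ 2) - v x * (-2 * x)) / (1 - x ^ 2) ^ 2) x :=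
    fun x hx => (h1 x hx).div (aux_p x) (aux_pos hx).ne'
  obtain ⟨K, hK⟩ := aux_Q2 hs (by
    intro x hx d hdd
    have := hdd.unique ((hasDerivAt_id x).mul (hd x hx))
    rw [this]
    have hp := (aux_pos hx).ne'
    have e := hW2 x (Set.Ioo_subset_Icc_self hx)
    simp only [id] at e ⊢
    field_simp
    linear_combination x * e - x * hW1)
  refine ⟨K, ?_⟩
  have hz : ∀ x ∈ Set.Ioo (-1 : ℝ) 1, x ≠ 0 → v x = K * x * (1 - x ^ 2) := by
    intro x hx h0
    have := hK x hx
    have hp := (aux_pos hx).ne'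
    field_simp at this
    linear_combination this
  have := aux_ext (g := fun x => v x - K * x * (1 - x ^ 2)) (by fun_prop)
    (fun x hx h0 => sub_eq_zero.2 (hz x hx h0))
  exact fun x hx => sub_eq_zero.1 (this x (Set.Ioo_subset_Icc_self hx))

theorem aux_lin {w w' : ℝ → ℝ}
    (c0 : ContinuousOn w (Set.Icc (-1 : ℝ) 1))
    (h1 : ∀ x ∈ Set.Ioo (-1 : ℝ) 1, HasDerivAt w (w' x) x)
    (h2 : ∀ x ∈ Set.Ioo (-1 : ℝ) 1, HasDerivAt w' 0 x)
    (e1 : w 1 = 0) (e2 : w (-1) = 0) : ∀ x ∈ Set.Ioo (-1 : ℝ) 1, w x = 0 := by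
  have a := aux_C h2
  have b := aux_C (g := fun x => w x - w' 0 * x) (by
    intro x hx
    refine ((h1 x hx).sub ((hasDerivAt_id x).const_mul (w' 0))).congr_deriv ?_
    rw [a x hx]; ring)
  have c := aux_ext (g := fun x => w x - w' 0 * x - (w 0 - w' 0 * 0)) (by fun_prop)
    (fun x hx _ => sub_eq_zero.2 (b x hx))
  have c1 := c 1 (by norm_num)
  have c2 := c (-1) (by norm_num)
  simp only [e1, e2] at c1 c2
  intro x hx
  have c3 := c x (Set.Ioo_subset_Icc_self hx)
  linear_combination c3 - (1 / 2) * (c1 + c2) - x / 2 * (c1 - c2)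

/-- The moduli space of smooth axisymmetric transverse deformations of
AdS₂×S² in Einstein–Maxwell theory is parameterised by three constants `(K₁, K₂, K₃)`. -/
theorem ads2s2_moduli_space (qe qm : ℝ) (hq : qe^2 + qm^2 > 0)
    (γ Q₁ Q₂ Q₃ : ℝ → ℝ)
    (hγ : ContDiffOn ℝ (⊤ : ℕ∞) γ (Set.Icc (-1 : ℝ) 1))
    (hQ₁ : ContDiffOn ℝ (⊤ : ℕ∞) Q₁ (Set.Icc (-1 : ℝ) 1))
    (hQ₂ : ContDiffOn ℝ (⊤ : ℕ∞) Q₂ (Set.Icc (-1 : ℝ) 1))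
    (hQ₃ : ContDiffOn ℝ (⊤ : ℕ∞) Q₃ (Set.Icc (-1 : ℝ) 1))
    (heq1 : ∀ x ∈ Set.Ioo (-1 : ℝ) 1,
      2 * qm * x^3 * (1 - x^2) * Efun γ Q₁ x - qe * Ffun Q₂ Q₃ x = 0)
    (heq2 : ∀ x ∈ Set.Ioo (-1 : ℝ) 1,
      2 * qe * x^3 * (1 - x^2) * Efun γ Q₁ x + qm * Ffun Q₂ Q₃ x = 0)
    (heq3 : ∀ x ∈ Set.Ioo (-1 : ℝ) 1,
      (1 - x^2) * iteratedDeriv 2 (fun y => (1 - y^2) * γ y) x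
        + 2 * x * deriv (fun y => (1 - y^2) * γ y) x
        + 2 * (1 - x^2) * γ x + 4 * (1 - x^2) * deriv Q₁ x + 8 * x * Q₁ x = 0)
    (heq4 : ∀ x ∈ Set.Ioo (-1 : ℝ) 1,
      -(x * (1 - x^2) * deriv Q₂ x) + 2 * (1 - 3 * x^2) * Q₂ x
        - 2 * x * (1 - x^2)^2 * deriv Q₃ x + 2 * (1 - x^2) * (1 - 3 * x^2) * Q₃ x = 0) :
    ∃ K₁ K₂ K₃ : ℝ, ∀ x ∈ Set.Ioo (-1 : ℝ) 1,
      Q₁ x = K₁ * x * (1 - x^2) ∧ γ x = 2 * K₁ * (1 - x^2)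
        ∧ Q₃ x = K₂ * (1 - x^2)
        ∧ Q₂ x = -K₂ * (1 - x^2)^2 + K₃ * x^2 * (1 - x^2)^2 := by
  have hEF : ∀ x ∈ Set.Ioo (-1 : ℝ) 1,
      x ^ 3 * (1 - x ^ 2) * Efun γ Q₁ x = 0 ∧ Ffun Q₂ Q₃ x = 0 := by
    intro x hx
    have a := heq1 x hx
    have b := heq2 x hx
    constructor
    · refine (mul_eq_zero.1 (?_ : (qe ^ 2 + qm ^ 2) * _ = 0)).resolve_left hq.ne'
      linear_combination (qm / 2) * a + (qe / 2) * b
    · refine (mul_eq_zero.1 (?_ : (qe ^ 2 + qm ^ 2) * _ = 0)).resolve_left hq.ne'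
      linear_combination (-qe) * a + qm * b
  set G : ℝ → ℝ := fun y => (1 - y ^ 2) * γ y with hG
  have sG : ContDiffOn ℝ (⊤ : ℕ∞) G (Set.Icc (-1 : ℝ) 1) :=
    ContDiffOn.mul (by fun_prop) hγ
  obtain ⟨G1, sG1, dG1⟩ := aux_D sG
  obtain ⟨G2, sG2, dG2⟩ := aux_D sG1
  obtain ⟨G3, sG3, dG3⟩ := aux_D sG2
  obtain ⟨U1, sU1, dU1⟩ := aux_D hQ₁
  obtain ⟨U2, sU2, dU2⟩ := aux_D sU1
  obtain ⟨T1, sT1, dT1⟩ := aux_D hQ₃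
  obtain ⟨T2, sT2, dT2⟩ := aux_D sT1
  obtain ⟨S1, sS1, dS1⟩ := aux_D hQ₂
  have cγ := hγ.continuousOn
  have cG := sG.continuousOn
  have cG1 := sG1.continuousOn
  have cG2 := sG2.continuousOn
  have cG3 := sG3.continuousOn
  have cU := hQ₁.continuousOn
  have cU1 := sU1.continuousOn
  have cU2 := sU2.continuousOn
  -- the Q₃ part
  obtain ⟨K2, hK2⟩ := aux_Q3 hQ₃.continuousOn sT1.continuousOn sT2.continuousOn dT1 dT2 (by
    intro x hx h0
    have a := (hEF x hx).2
    have b := heq4 x hx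
    rw [Ffun, aux_deriv2 dT1 dT2 x hx, (dT1 x hx).deriv] at a
    rw [(dT1 x hx).deriv] at b
    have hp := (aux_pos hx).ne'
    have : (x ^ 2 * (1 - x ^ 2)) * ((1 - x ^ 2) * T2 x + 2 * Q₃ x) = 0 := by
      linear_combination -a - b
    exact (mul_eq_zero.1 this).resolve_left (mul_ne_zero (pow_ne_zero 2 h0) hp))
  have hT1 : ∀ x ∈ Set.Ioo (-1 : ℝ) 1, T1 x = K2 * (-2 * x) := by
    intro x hx
    have := aux_Z (g := fun y => Q₃ y - K2 * (1 - y ^ 2))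
      (fun y hy => sub_eq_zero.2 (hK2 y hy)) hx ((dT1 x hx).sub ((aux_p x).const_mul K2))
    linarith
  -- the Q₂ part
  have hsR : ContDiffOn ℝ (⊤ : ℕ∞)
      (fun x => Q₂ x / (1 - x ^ 2) ^ 2 + K2) (Set.Ioo (-1 : ℝ) 1) := by
    refine ContDiffOn.add ((hQ₂.mono Set.Ioo_subset_Icc_self).div (by fun_prop) ?_) (by fun_prop)
    exact fun x hx => (pow_pos (aux_pos hx) 2).ne'
  obtain ⟨K3, hK3⟩ := aux_Q2 hsR (by
    intro x hx d hd
    have hp := (aux_pos hx).ne'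
    have := hd.unique (((dS1 x hx).div ((aux_p x).pow 2) (pow_ne_zero 2 hp)).add_const K2)
    rw [this]
    have b := heq4 x hx
    rw [(dT1 x hx).deriv, hT1 x hx, (dS1 x hx).deriv, hK2 x hx] at b
    simp only [Pi.pow_apply]
    field_simp
    push_cast
    ring_nf at b ⊢
    linear_combination (x ^ 2 - 1) * b)
  -- the (γ, Q₁) part
  have hE := aux_ext (g := fun x => G1 x - (1 - x ^ 2) * U2 x + 2 * Q₁ x) (by fun_prop) (by
    intro x hx h0
    have a := (hEF x hx).1
    rw [Efun, aux_deriv2 dU1 dU2 x hx, ← hG, (dG1 x hx).deriv] at a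
    exact (mul_eq_zero.1 a).resolve_left
      (mul_ne_zero (pow_ne_zero 3 h0) (aux_pos hx).ne'))
  have h3 := aux_ext (g := fun x => (1 - x ^ 2) * G2 x + 2 * x * G1 x + 2 * G x
      + 4 * ((1 - x ^ 2) * U1 x) + 8 * x * Q₁ x) (by fun_prop) (by
    intro x hx h0
    have a := heq3 x hx
    rw [aux_deriv2 dG1 dG2 x hx, (dG1 x hx).deriv, (dU1 x hx).deriv] at a
    simp only [hG]
    linear_combination a)
  have h3' : ∀ x ∈ Set.Ioo (-1 : ℝ) 1,
      (1 - x ^ 2) * G3 x + 4 * G1 x + 4 * (1 - x ^ 2) * U2 x + 8 * Q₁ x = 0 := by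
    intro x hx
    have := aux_Z (fun y hy => h3 y (Set.Ioo_subset_Icc_self hy)) hx
      ((((((aux_p x).mul (dG3 x hx)).add (((hasDerivAt_id x).const_mul 2).mul (dG2 x hx))).add
        ((dG1 x hx).const_mul 2)).add (((aux_p x).mul (dU2 x hx)).const_mul 4)).add
        (((hasDerivAt_id x).const_mul 8).mul (dU1 x hx)))
    simp only [id] at this
    linear_combination this
  obtain ⟨c, hc⟩ := aux_v (v := fun x => 2 * Q₁ x + G1 x) (v' := fun x => 2 * U1 x + G2 x)
    (v'' := fun x => 2 * U2 x + G3 x) (ContDiffOn.add (contDiffOn_const.mul hQ₁) sG1)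
    (by fun_prop) (by fun_prop)
    (fun x hx => ((dU1 x hx).const_mul 2).add (dG2 x hx))
    (fun x hx => ((dU2 x hx).const_mul 2).add (dG3 x hx)) (by
      intro x hx
      have a := hE x (Set.Ioo_subset_Icc_self hx)
      have b := h3' x hx
      linear_combination b + 2 * a)
  have hw := aux_lin (w := fun x => 8 * Q₁ x + G1 x) (w' := fun x => 8 * U1 x + G2 x)
    (by fun_prop) (fun x hx => ((dU1 x hx).const_mul 8).add (dG2 x hx))
    (fun x hx => (((dU2 x hx).const_mul 8).add (dG3 x hx)).congr_deriv (by
      have a := hE x (Set.Ioo_subset_Icc_self hx)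
      have b := h3' x hx
      refine (mul_eq_zero.1 (?_ : (1 - x ^ 2) * _ = 0)).resolve_left (aux_pos hx).ne'
      linear_combination b - 4 * a))
    (by
      have a := hE 1 (by norm_num)
      have b := h3 1 (by norm_num)
      simp only [hG] at a b ⊢
      linear_combination (3/2) * b - 2 * a)
    (by
      have a := hE (-1) (by norm_num)
      have b := h3 (-1) (by norm_num)
      simp only [hG] at a b ⊢
      linear_combination (-3/2) * b - 2 * a)
  have hU : ∀ x ∈ Set.Ioo (-1 : ℝ) 1, Q₁ x = (-c / 6) * (x * (1 - x ^ 2)) := by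
    intro x hx
    have a := hc x hx
    have b := hw x hx
    linear_combination (b - a) / 6
  have hU1 : ∀ x ∈ Set.Ioo (-1 : ℝ) 1, U1 x = (-c / 6) * (1 - 3 * x ^ 2) := by
    intro x hx
    have := aux_Z (fun y hy => sub_eq_zero.2 (hU y hy)) hx
      ((dU1 x hx).sub (((hasDerivAt_id x).mul (aux_p x)).const_mul (-c / 6)))
    simp only [id] at this
    linear_combination this
  have hG2 : ∀ x ∈ Set.Ioo (-1 : ℝ) 1, G2 x = -8 * U1 x := by
    intro x hx
    have := aux_Z hw hx (((dU1 x hx).const_mul 8).add (dG2 x hx))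
    linarith
  refine ⟨-c / 6, K2, K3, fun x hx => ⟨?_, ?_, hK2 x hx, ?_⟩⟩
  · rw [hU x hx]; ring
  · have a := h3 x (Set.Ioo_subset_Icc_self hx)
    have b := hw x hx
    simp only [hG] at a b
    rw [hG2 x hx, hU1 x hx] at a
    rw [hU x hx] at a b
    refine mul_left_cancel₀ (aux_pos hx).ne' ?_
    linear_combination a / 2 - x * b
  · have a := hK3 x hx
    have hp := (aux_pos hx).ne'
    field_simp at a
    linear_combination a
end

section
/- Every six-times continuously differentiable function Q : (-1,1) → ℝ satisfying (1-x²)²Q⁽⁶⁾(x) - 12x(1-x²)Q⁽⁵⁾(x) - 6(1-5x²)Q⁽⁴⁾(x) = 0 for all x ∈ (-1,1), and whose fourth derivative Q⁽⁴⁾ is bounded on (-1,1), is a polynomial of degree at most 3. -/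
lemma kn_prim (f p g : ℝ → ℝ) (hf : ∀ x ∈ Set.Ioo (-1 : ℝ) 1, HasDerivAt f (g x) x)
    (hp : ∀ x ∈ Set.Ioo (-1 : ℝ) 1, HasDerivAt p (g x) x) :
    ∃ c, ∀ x ∈ Set.Ioo (-1 : ℝ) 1, f x = p x + c := by
  have h : ∀ x ∈ Set.Ioo (-1 : ℝ) 1, HasDerivAt (fun y => f y - p y) 0 x := fun x hx => by
    simpa using (hf x hx).fun_sub (hp x hx)
  refine ⟨f 0 - p 0, fun x hx => ?_⟩
  have := isOpen_Ioo.is_const_of_deriv_eq_zero (isPreconnected_Ioo)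
    (fun y hy => (h y hy).differentiableAt.differentiableWithinAt)
    (fun y hy => (h y hy).deriv) hx (show (0:ℝ) ∈ Set.Ioo (-1 : ℝ) 1 by norm_num)
  try simp only at this
  linarith

/-- Every C⁶ function `Q` on `(-1,1)` satisfying
`(1-x²)²Q⁽⁶⁾ - 12x(1-x²)Q⁽⁵⁾ - 6(1-5x²)Q⁽⁴⁾ = 0` whose fourth derivative is bounded
is a polynomial of degree at most 3. -/
theorem kerr_newman_sixth_order_ode_polynomial (Q : ℝ → ℝ)
    (hQdiff : ∀ k ≤ 5, ∀ x ∈ Set.Ioo (-1 : ℝ) 1, DifferentiableAt ℝ (iteratedDeriv k Q) x)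
    (hQcont : ContinuousOn (iteratedDeriv 6 Q) (Set.Ioo (-1 : ℝ) 1))
    (hODE : ∀ x ∈ Set.Ioo (-1 : ℝ) 1,
      (1 - x^2)^2 * iteratedDeriv 6 Q x - 12 * x * (1 - x^2) * iteratedDeriv 5 Q x
        - 6 * (1 - 5 * x^2) * iteratedDeriv 4 Q x = 0)
    (hbdd : ∃ M : ℝ, ∀ x ∈ Set.Ioo (-1 : ℝ) 1, |iteratedDeriv 4 Q x| ≤ M) :
    ∃ a b c d : ℝ, ∀ x ∈ Set.Ioo (-1 : ℝ) 1, Q x = a + b * x + c * x^2 + d * x^3 := by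
  obtain ⟨M, hM⟩ := hbdd
  have hD : ∀ k ≤ 5, ∀ x ∈ Set.Ioo (-1 : ℝ) 1,
      HasDerivAt (iteratedDeriv k Q) (iteratedDeriv (k+1) Q x) x := fun k hk x hx => by
    rw [iteratedDeriv_succ]; exact (hQdiff k hk x hx).hasDerivAt
  have hw : ∀ x : ℝ, HasDerivAt (fun y : ℝ => 1 - y^2) (-(2*x)) x := fun x => by
    simpa using ((hasDerivAt_id x).fun_pow 2).const_sub 1
  have h1 : ∀ x ∈ Set.Ioo (-1 : ℝ) 1, HasDerivAt (fun y => (1-y^2)^3 * iteratedDeriv 4 Q y)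
      ((1-x^2)^3 * iteratedDeriv 5 Q x - 6*x*(1-x^2)^2 * iteratedDeriv 4 Q x) x := fun x hx => by
    refine (((hw x).fun_pow 3).fun_mul (hD 4 (by norm_num) x hx)).congr_deriv ?_
    push_cast; ring
  have h2 : ∀ x ∈ Set.Ioo (-1 : ℝ) 1, HasDerivAt (fun x =>
      (1-x^2)^3 * iteratedDeriv 5 Q x - 6*x*(1-x^2)^2 * iteratedDeriv 4 Q x) 0 x := fun x hx => by
    refine ((((hw x).fun_pow 3).fun_mul (hD 5 (by norm_num) x hx)).fun_sub
      ((((hasDerivAt_id x).const_mul 6).fun_mul ((hw x).fun_pow 2)).fun_mul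
        (hD 4 (by norm_num) x hx))).congr_deriv ?_
    have := hODE x hx
    simp only [id]
    push_cast
    linear_combination (1-x^2) * this
  obtain ⟨β, hβ⟩ := kn_prim _ (fun _ => 0) _ h2 (fun x _ => hasDerivAt_const x 0)
  obtain ⟨α, hα⟩ := kn_prim _ (fun x => β * x) _ h1 (fun x hx => by
    refine ((hasDerivAt_id x).const_mul β).congr_deriv ?_
    have := hβ x hx
    try simp only at this
    rw [this]; ring)
  have hb : ∀ x ∈ Set.Icc (-1 : ℝ) 1, |β * x + α| ≤ (1-x^2)^3 * M := by
    have hc : Set.Icc (-1 : ℝ) 1 = closure (Set.Ioo (-1 : ℝ) 1) :=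
      (closure_Ioo (by norm_num)).symm
    intro x hx
    rw [hc] at hx
    refine le_on_closure (f := fun x => |β * x + α|) (g := fun x => (1-x^2)^3 * M)
      (fun y hy => ?_) (by fun_prop) (by fun_prop) hx
    have h0 : 0 ≤ (1 - y^2)^3 := pow_nonneg (by nlinarith [hy.1, hy.2]) 3
    have := hα y hy
    try simp only at this ⊢
    rw [← this, abs_mul, abs_of_nonneg h0]
    exact mul_le_mul_of_nonneg_left (hM y hy) h0
  have e1 := hb 1 (by norm_num)
  have e2 := hb (-1) (by norm_num)
  norm_num at e1 e2
  have hβ0 : β = 0 := by linarith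
  have hα0 : α = 0 := by linarith
  have hu : ∀ x ∈ Set.Ioo (-1 : ℝ) 1, iteratedDeriv 4 Q x = 0 := fun x hx => by
    have := hα x hx
    simp only [hβ0, hα0, zero_mul, add_zero] at this
    have h0 : 0 < 1 - x^2 := by nlinarith [hx.1, hx.2]
    exact (mul_eq_zero.1 this).resolve_left (pow_pos h0 3).ne'
  obtain ⟨d, hd⟩ := kn_prim _ (fun _ => 0) _ (hD 3 (by norm_num)) (fun x hx => by
    rw [hu x hx]; exact hasDerivAt_const x 0)
  obtain ⟨c, hc⟩ := kn_prim _ (fun x => d * x) _ (hD 2 (by norm_num)) (fun x hx => by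
    rw [hd x hx]
    exact ((hasDerivAt_id x).const_mul d).congr_deriv (by ring))
  obtain ⟨b, hb⟩ := kn_prim _ (fun x => d/2 * x^2 + c * x) _ (hD 1 (by norm_num)) (fun x hx => by
    rw [hc x hx]
    refine ((((hasDerivAt_id x).fun_pow 2).const_mul (d/2)).fun_add
      ((hasDerivAt_id x).const_mul c)).congr_deriv ?_
    simp only [id]; push_cast; ring)
  obtain ⟨a, ha⟩ := kn_prim _ (fun x => d/6 * x^3 + c/2 * x^2 + b * x) _ (hD 0 (by norm_num))
    (fun x hx => by
    rw [hb x hx]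
    refine (((((hasDerivAt_id x).fun_pow 3).const_mul (d/6)).fun_add
      (((hasDerivAt_id x).fun_pow 2).const_mul (c/2))).fun_add
      ((hasDerivAt_id x).const_mul b)).congr_deriv ?_
    simp only [id]; push_cast; ring)
  refine ⟨a, b, c/2, d/6, fun x hx => ?_⟩
  have := ha x hx
  simp only [iteratedDeriv_zero] at this
  rw [this]; ring
end

section
/- Let 0 < s < 1/3 and define on (-1,1): P(x) = 1 - 3s²x² - s(1+x²), α₁(x) = (1-x²)³P(x)³, α₂(x) = -4(1-3s)²(1-x²)P(x)·(3s²x⁴ + s(x⁴+6x²-1) + 2x²+1), and α₃(x) = 8x(1-3s)²·(9s⁴x⁶ + 3s³(2x⁶+9x⁴-4x²+1) + s²x²(x⁴+18x²-1) + s(3x⁴-2x²-1) - x² - 2). Then the function X₀(x) = (1-x²)(4 - (1+3s)²x²)/(4P(x)) is well defined and satisfies α₁(x)X₀'''(x) + α₂(x)X₀'(x) + α₃(x)X₀(x) = 0 for all x ∈ (-1,1). -/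
/-- `P(x) = 1 - 3s²x² - s(1+x²)`. -/
def kerrAdSP (s x : ℝ) : ℝ := 1 - 3 * s^2 * x^2 - s * (1 + x^2)

/-- `α₁(x) = (1-x²)³ P(x)³`. -/
def kerrAdSα₁ (s x : ℝ) : ℝ := (1 - x^2)^3 * (kerrAdSP s x)^3

/-- `α₂(x) = -4(1-3s)²(1-x²)P(x)(3s²x⁴ + s(x⁴+6x²-1) + 2x²+1)`. -/
def kerrAdSα₂ (s x : ℝ) : ℝ :=
  -4 * (1 - 3 * s)^2 * (1 - x^2) * kerrAdSP s x
    * (3 * s^2 * x^4 + s * (x^4 + 6 * x^2 - 1) + 2 * x^2 + 1)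

/-- `α₃(x) = 8x(1-3s)²(9s⁴x⁶ + 3s³(2x⁶+9x⁴-4x²+1) + s²x²(x⁴+18x²-1) + s(3x⁴-2x²-1) - x² - 2)`. -/
def kerrAdSα₃ (s x : ℝ) : ℝ :=
  8 * x * (1 - 3 * s)^2
    * (9 * s^4 * x^6 + 3 * s^3 * (2 * x^6 + 9 * x^4 - 4 * x^2 + 1)
      + s^2 * x^2 * (x^4 + 18 * x^2 - 1) + s * (3 * x^4 - 2 * x^2 - 1) - x^2 - 2)

/-- `X₀(x) = (1-x²)(4 - (1+3s)²x²)/(4P(x))`, the extreme Kerr-AdS deformation. -/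
noncomputable def kerrAdSX₀ (s x : ℝ) : ℝ :=
  (1 - x^2) * (4 - (1 + 3 * s)^2 * x^2) / (4 * kerrAdSP s x)

lemma kerr_hP (s x : ℝ) : HasDerivAt (kerrAdSP s) (-(2 * (3 * s^2 + s) * x)) x := by
  have h := ((hasDerivAt_pow 2 x).const_mul (-(3 * s^2 + s))).const_add (1 - s)
  have e : kerrAdSP s = fun y => (1 - s) + (-(3 * s^2 + s)) * y^2 := by
    funext y; unfold kerrAdSP; ring
  rw [e]
  refine h.congr_deriv ?_
  push_cast; ring

/-- quotient rule in the shape used here. -/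
lemma kerr_quot (s x : ℝ) (n : ℕ) (f : ℝ → ℝ) (f' : ℝ) (hf : HasDerivAt f f' x)
    (hx : kerrAdSP s x ≠ 0) :
    HasDerivAt (fun y => f y / (4 * kerrAdSP s y ^ (n + 1)))
      ((f' * kerrAdSP s x - (n + 1) * f x * (-(2 * (3 * s^2 + s) * x)))
        / (4 * kerrAdSP s x ^ (n + 2))) x := by
  have h := hf.fun_div (((kerr_hP s x).fun_pow (n + 1)).const_mul 4)
    (mul_ne_zero four_ne_zero (pow_ne_zero _ hx))
  refine h.congr_deriv ?_
  rw [Nat.add_sub_cancel]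
  push_cast
  field_simp
  try ring

lemma kerr_poly (a b c x : ℝ) :
    HasDerivAt (fun y : ℝ => a + b * y^2 + c * y^4) (2 * b * x + 4 * c * x^3) x := by
  have h := (((hasDerivAt_pow 2 x).const_mul b).const_add a).fun_add
    ((hasDerivAt_pow 4 x).const_mul c)
  refine h.congr_deriv ?_
  push_cast; ring

lemma kerr_polyo (a b c x : ℝ) :
    HasDerivAt (fun y : ℝ => a * y + b * y^3 + c * y^5) (a + 3 * b * x^2 + 5 * c * x^4) x := by
  have h := (((hasDerivAt_id' x).const_mul a).fun_add ((hasDerivAt_pow 3 x).const_mul b)).fun_add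
    ((hasDerivAt_pow 5 x).const_mul c)
  refine h.congr_deriv ?_
  push_cast; ring

lemma kerr_polye (a b c d x : ℝ) :
    HasDerivAt (fun y : ℝ => a + b * y^2 + c * y^4 + d * y^6)
      (2 * b * x + 4 * c * x^3 + 6 * d * x^5) x := by
  have h := (kerr_poly a b c x).fun_add ((hasDerivAt_pow 6 x).const_mul d)
  refine h.congr_deriv ?_
  push_cast; ring

/-- For `0 < s < 1/3`, the function `X₀` is well defined on `(-1,1)`
(its denominator never vanishes) and satisfies `α₁X₀''' + α₂X₀' + α₃X₀ = 0` there. -/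
theorem kerrAdS_X₀_solves_ode (s : ℝ) (hs0 : 0 < s) (hs : s < 1/3) :
    ∀ x ∈ Set.Ioo (-1 : ℝ) 1,
      kerrAdSP s x ≠ 0
        ∧ kerrAdSα₁ s x * iteratedDeriv 3 (kerrAdSX₀ s) x
            + kerrAdSα₂ s x * deriv (kerrAdSX₀ s) x
            + kerrAdSα₃ s x * kerrAdSX₀ s x = 0 := by
  have hopen : IsOpen {y : ℝ | kerrAdSP s y ≠ 0} :=
    isOpen_ne_fun (by unfold kerrAdSP; fun_prop) continuous_const
  obtain ⟨a, ha⟩ : ∃ a, a = -2 * (4 + (1 + 3 * s)^2) * (1 - s) + 8 * (3 * s^2 + s) := ⟨_, rfl⟩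
  obtain ⟨b, hb⟩ : ∃ b, b = 4 * (1 + 3 * s)^2 * (1 - s) := ⟨_, rfl⟩
  obtain ⟨c, hc⟩ : ∃ c, c = -2 * (1 + 3 * s)^2 * (3 * s^2 + s) := ⟨_, rfl⟩
  obtain ⟨A, hA⟩ : ∃ A, A = a * (1 - s) := ⟨_, rfl⟩
  obtain ⟨B, hB⟩ : ∃ B, B = 3 * b * (1 - s) + 3 * (3 * s^2 + s) * a := ⟨_, rfl⟩
  obtain ⟨C, hC⟩ : ∃ C, C = 5 * c * (1 - s) + (3 * s^2 + s) * b := ⟨_, rfl⟩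
  obtain ⟨D, hD⟩ : ∃ D, D = -(3 * s^2 + s) * c := ⟨_, rfl⟩
  have h1 : ∀ y, kerrAdSP s y ≠ 0 → HasDerivAt (kerrAdSX₀ s)
      ((a * y + b * y^3 + c * y^5) / (4 * kerrAdSP s y ^ 2)) y := by
    intro y hy
    have h := kerr_quot s y 0 _ _ (kerr_poly 4 (-(4 + (1 + 3 * s)^2)) ((1 + 3 * s)^2) y) hy
    convert h using 1
    · funext z; unfold kerrAdSX₀; rw [zero_add, pow_one]; congr 1; ring
    · congr 1; subst ha hb hc; unfold kerrAdSP; push_cast; ring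
  have h2 : ∀ y, kerrAdSP s y ≠ 0 →
      HasDerivAt (fun z => (a * z + b * z^3 + c * z^5) / (4 * kerrAdSP s z ^ 2))
      ((A + B * y^2 + C * y^4 + D * y^6) / (4 * kerrAdSP s y ^ 3)) y := by
    intro y hy
    have h := kerr_quot s y 1 _ _ (kerr_polyo a b c y) hy
    convert h using 1
    congr 1; subst hA hB hC hD; unfold kerrAdSP; push_cast; ring
  intro x hx
  have hPx : kerrAdSP s x ≠ 0 := by
    have hx2 : x^2 < 1 := by nlinarith [hx.1, hx.2]
    have : 0 < kerrAdSP s x := by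
      unfold kerrAdSP
      nlinarith [mul_pos (show 0 < 3 * s^2 + s by positivity) (sub_pos.2 hx2),
        mul_pos (show 0 < 1 - 3 * s by linarith) (show 0 < 1 + s by linarith)]
    exact this.ne'
  refine ⟨hPx, ?_⟩
  have h3 := kerr_quot s x 2 _ _ (kerr_polye A B C D x) hPx
  have e1 : ∀ y, kerrAdSP s y ≠ 0 → deriv (kerrAdSX₀ s) y =
      (a * y + b * y^3 + c * y^5) / (4 * kerrAdSP s y ^ 2) := fun y hy => (h1 y hy).deriv
  have e2 : ∀ y, kerrAdSP s y ≠ 0 → deriv (deriv (kerrAdSX₀ s)) y =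
      (A + B * y^2 + C * y^4 + D * y^6) / (4 * kerrAdSP s y ^ 3) := fun y hy => by
    rw [Filter.EventuallyEq.deriv_eq (Filter.eventually_of_mem (hopen.mem_nhds hy) e1)]
    exact (h2 y hy).deriv
  have e3 : iteratedDeriv 3 (kerrAdSX₀ s) x =
      ((2 * B * x + 4 * C * x ^ 3 + 6 * D * x ^ 5) * kerrAdSP s x -
        ((2 : ℕ) + 1) * (A + B * x ^ 2 + C * x ^ 4 + D * x ^ 6) * -(2 * (3 * s ^ 2 + s) * x)) /
      (4 * kerrAdSP s x ^ (2 + 2)) := by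
    rw [iteratedDeriv_succ, iteratedDeriv_succ, iteratedDeriv_one,
      Filter.EventuallyEq.deriv_eq (Filter.eventually_of_mem (hopen.mem_nhds hPx) e2)]
    exact h3.deriv
  rw [e3, e1 x hPx]
  unfold kerrAdSα₁ kerrAdSα₂ kerrAdSα₃ kerrAdSX₀
  obtain ⟨P, hP⟩ : ∃ P, P = kerrAdSP s x := ⟨_, rfl⟩
  rw [← hP] at hPx ⊢
  unfold kerrAdSP at hP
  push_cast
  field_simp
  subst hA hB hC hD
  subst ha hb hc hP
  ring
end

section
/- Let 0 < s < 1/3 and let P, α₁, α₂, α₃ be as follows on (-1,1): P(x) = 1 - 3s²x² - s(1+x²), α₁(x) = (1-x²)³P(x)³, α₂(x) = -4(1-3s)²(1-x²)P(x)·(3s²x⁴ + s(x⁴+6x²-1) + 2x²+1), α₃(x) = 8x(1-3s)²·(9s⁴x⁶ + 3s³(2x⁶+9x⁴-4x²+1) + s²x²(x⁴+18x²-1) + s(3x⁴-2x²-1) - x² - 2). Then every function X : (-1,1) → ℝ which extends to a C^∞ function on [-1,1] and satisfies α₁X''' + α₂X' + α₃X = 0 on (-1,1) is a constant multiple of X₀(x)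 = (1-x²)(4 - (1+3s)²x²)/(4P(x)). -/
lemma kconv {f g : ℝ → ℝ} {f' g' x : ℝ} (h : HasDerivAt f f' x) (h1 : ∀ y, g y = f y)
    (h2 : g' = f') : HasDerivAt g g' x := by
  have : g = f := funext h1
  rw [this, h2]; exact h

def kN0 (s x : ℝ) : ℝ := (1 - x^2) * (4 - (1 + 3 * s)^2 * x^2)
def kN1 (s x : ℝ) : ℝ := (-10)*s^0*x^1 + (6)*s^1*x^1 + (18)*s^2*x^1 + (18)*s^3*x^1 +
      (4)*s^0*x^3 + (20)*s^1*x^3 + (12)*s^2*x^3 + (-36)*s^3*x^3 + (-2)*s^1*x^5 + (-18)*s^2*x^5 +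
      (-54)*s^3*x^5 + (-54)*s^4*x^5
def kN2 (s x : ℝ) : ℝ := (-10)*s^0*x^0 + (16)*s^1*x^0 + (12)*s^2*x^0 + (-18)*s^4*x^0 +
      (12)*s^0*x^2 + (18)*s^1*x^2 + (-96)*s^2*x^2 + (-36)*s^3*x^2 + (324)*s^4*x^2 +
      (162)*s^5*x^2 + (-6)*s^1*x^4 + (-48)*s^2*x^4 + (-108)*s^3*x^4 + (162)*s^5*x^4 +
      (2)*s^2*x^6 + (24)*s^3*x^6 + (108)*s^4*x^6 + (216)*s^5*x^6 + (162)*s^6*x^6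
def kN3 (s x : ℝ) : ℝ := (24)*s^0*x^1 + (-48)*s^1*x^1 + (-312)*s^2*x^1 + (480)*s^3*x^1 +
      (936)*s^4*x^1 + (-432)*s^5*x^1 + (-648)*s^6*x^1 + (24)*s^1*x^3 + (48)*s^2*x^3 +
      (-408)*s^3*x^3 + (-864)*s^4*x^3 + (1512)*s^5*x^3 + (3888)*s^6*x^3 + (1944)*s^7*x^3

noncomputable def kU0 (s x : ℝ) : ℝ := kN0 s x / (4 * kerrAdSP s x)
noncomputable def kU1 (s x : ℝ) : ℝ := kN1 s x / (4 * kerrAdSP s x ^ 2)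
noncomputable def kU2 (s x : ℝ) : ℝ := kN2 s x / (4 * kerrAdSP s x ^ 3)
noncomputable def kU3 (s x : ℝ) : ℝ := kN3 s x / (4 * kerrAdSP s x ^ 4)

lemma kT_pos_aux (s c u v : ℝ) (hs : 0 < s) (hc : 0 < c) (hu : 0 ≤ u) (hv : 0 < v) :
    0 < (32/3)*c^0*(3*s)^6*v^4*u^0 + (64)*c^1*(3*s)^5*v^3*u^1 + (256/3)*c^1*(3*s)^5*v^4*u^0 +
      (320/3)*c^2*(3*s)^4*v^2*u^2 + (368)*c^2*(3*s)^4*v^3*u^1 + (832/3)*c^2*(3*s)^4*v^4*u^0 +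
      (256/3)*c^3*(3*s)^3*v^0*u^4 + (256)*c^3*(3*s)^3*v^1*u^3 + (1760/3)*c^3*(3*s)^3*v^2*u^2 +
      (2648/3)*c^3*(3*s)^3*v^3*u^1 + (472)*c^3*(3*s)^3*v^4*u^0 + (192)*c^4*(3*s)^2*v^0*u^4 +
      (608)*c^4*(3*s)^2*v^1*u^3 + (3100/3)*c^4*(3*s)^2*v^2*u^2 + (3188/3)*c^4*(3*s)^2*v^3*u^1 +
      (446)*c^4*(3*s)^2*v^4*u^0 + (144)*c^5*(3*s)^1*v^0*u^4 + (480)*c^5*(3*s)^1*v^1*u^3 +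
      (2230/3)*c^5*(3*s)^1*v^2*u^2 + (630)*c^5*(3*s)^1*v^3*u^1 + (668/3)*c^5*(3*s)^1*v^4*u^0 +
      (36)*c^6*(3*s)^0*v^0*u^4 + (126)*c^6*(3*s)^0*v^1*u^3 + (190)*c^6*(3*s)^0*v^2*u^2 +
      (146)*c^6*(3*s)^0*v^3*u^1 + (46)*c^6*(3*s)^0*v^4*u^0 := by
  positivity

lemma kT_pos (s x : ℝ) (hs0 : 0 < s) (hs : s < 1/3) (hx : x ∈ Set.Ioo (-1 : ℝ) 1) :
    0 < 4 * (1 - 3 * s)^2 * (3 * s^2 * x^4 + s * (x^4 + 6 * x^2 - 1) + 2 * x^2 + 1)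
      * (4 - (1 + 3 * s)^2 * x^2) - 3 * (1 - x^2) * kN2 s x := by
  have h := kT_pos_aux s (1 - 3 * s) (x^2) (1 - x^2) hs0 (by linarith) (sq_nonneg x)
    (by nlinarith [hx.1, hx.2])
  refine h.trans_eq ?_
  unfold kN2
  ring

lemma kP_pos (s x : ℝ) (hs0 : 0 < s) (hs : s < 1/3) (hx : x ∈ Set.Icc (-1 : ℝ) 1) :
    0 < kerrAdSP s x := by
  have h1 : x^2 ≤ 1 := by nlinarith [hx.1, hx.2]
  have h2 : kerrAdSP s x = (1 - 3 * s) * (1 + s) + s * (1 + 3 * s) * (1 - x^2) := by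
    unfold kerrAdSP; ring
  rw [h2]
  have : 0 < (1 - 3 * s) * (1 + s) := mul_pos (by linarith) (by linarith)
  have : 0 ≤ s * (1 + 3 * s) * (1 - x^2) :=
    mul_nonneg (by positivity) (by linarith)
  linarith

lemma kF_pos (s x : ℝ) (hs0 : 0 < s) (hs : s < 1/3) (hx : x ∈ Set.Icc (-1 : ℝ) 1) :
    0 < 4 - (1 + 3 * s)^2 * x^2 := by
  have h1 : x^2 ≤ 1 := by nlinarith [hx.1, hx.2]
  have h2 : (1 + 3 * s)^2 < 4 := by nlinarith
  nlinarith [sq_nonneg (1 + 3 * s)]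

lemma kU0_pos (s x : ℝ) (hs0 : 0 < s) (hs : s < 1/3) (hx : x ∈ Set.Ioo (-1 : ℝ) 1) :
    0 < kU0 s x := by
  have h := kP_pos s x hs0 hs (Set.Ioo_subset_Icc_self hx)
  have h1 := kF_pos s x hs0 hs (Set.Ioo_subset_Icc_self hx)
  have h2 : 0 < 1 - x^2 := by nlinarith [hx.1, hx.2]
  unfold kU0 kN0
  positivity

lemma kP_deriv (s x : ℝ) : HasDerivAt (kerrAdSP s) (-6 * s^2 * x - 2 * s * x) x := by
  have := ((((hasDerivAt_id x).pow 2).const_mul (-(3 * s^2 + s))).add_const (1 - s))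
  refine kconv this (fun y => ?_) ?_
  · simp [kerrAdSP]; ring
  · simp; ring

lemma kquot (s x n' : ℝ) (N : ℝ → ℝ) (k : ℕ) (hN : HasDerivAt N n' x) (hP : kerrAdSP s x ≠ 0) :
    HasDerivAt (fun y => N y / (4 * kerrAdSP s y ^ (k + 1)))
      ((n' * kerrAdSP s x - (k + 1) * N x * (-6 * s^2 * x - 2 * s * x))
        / (4 * kerrAdSP s x ^ (k + 2))) x := by
  have := hN.div (((kP_deriv s x).pow (k + 1)).const_mul 4)
    (mul_ne_zero four_ne_zero (pow_ne_zero _ hP))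
  refine kconv this (fun y => rfl) ?_
  push_cast
  simp only [Pi.pow_apply, Nat.add_sub_cancel]
  field_simp
  ring

lemma kmono (a x : ℝ) (n : ℕ) : HasDerivAt (fun y : ℝ => a * y ^ n) (a * (n * x ^ (n - 1))) x :=
  (hasDerivAt_pow n x).const_mul a

lemma kU0_deriv (s x : ℝ) (hP : kerrAdSP s x ≠ 0) : HasDerivAt (kU0 s) (kU1 s x) x := by
  have hN : HasDerivAt (kN0 s) (-2 * (5 + 6 * s + 9 * s^2) * x + 4 * (1 + 3 * s)^2 * x^3) x := by
    have := ((kmono (-(5 + 6 * s + 9 * s^2)) x 2).add (kmono ((1 + 3 * s)^2) x 4)).add_const 4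
    refine kconv this (fun y => ?_) ?_
    · simp [kN0]; ring
    · norm_num; ring
  have := kquot s x _ _ 0 hN hP
  refine kconv this (fun y => ?_) ?_
  · simp [kU0]
  · unfold kU1 kN1 kN0
    congr 1
    unfold kerrAdSP; push_cast; ring

lemma kU1_deriv (s x : ℝ) (hP : kerrAdSP s x ≠ 0) : HasDerivAt (kU1 s) (kU2 s x) x := by
  have hN : HasDerivAt (kN1 s) ((-10 + 6 * s + 18 * s^2 + 18 * s^3)
      + 3 * (4 + 20 * s + 12 * s^2 - 36 * s^3) * x^2
      + 5 * (-2 * s - 18 * s^2 - 54 * s^3 - 54 * s^4) * x^4) x := by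
    have := ((kmono (-10 + 6 * s + 18 * s^2 + 18 * s^3) x 1).add
      (kmono (4 + 20 * s + 12 * s^2 - 36 * s^3) x 3)).add
      (kmono (-2 * s - 18 * s^2 - 54 * s^3 - 54 * s^4) x 5)
    refine kconv this (fun y => ?_) ?_
    · simp [kN1]; ring
    · norm_num; ring
  have := kquot s x _ _ 1 hN hP
  refine kconv this (fun y => rfl) ?_
  · unfold kU2 kN2 kN1
    congr 1
    unfold kerrAdSP; push_cast; ring

lemma kU2_deriv (s x : ℝ) (hP : kerrAdSP s x ≠ 0) : HasDerivAt (kU2 s) (kU3 s x) x := by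
  have hN : HasDerivAt (kN2 s) (2 * (12 + 18 * s - 96 * s^2 - 36 * s^3 + 324 * s^4 + 162 * s^5) * x
      + 4 * (-6 * s - 48 * s^2 - 108 * s^3 + 162 * s^5) * x^3
      + 6 * (2 * s^2 + 24 * s^3 + 108 * s^4 + 216 * s^5 + 162 * s^6) * x^5) x := by
    have := (((kmono (12 + 18 * s - 96 * s^2 - 36 * s^3 + 324 * s^4 + 162 * s^5) x 2).add
      (kmono (-6 * s - 48 * s^2 - 108 * s^3 + 162 * s^5) x 4)).add
      (kmono (2 * s^2 + 24 * s^3 + 108 * s^4 + 216 * s^5 + 162 * s^6) x 6)).add_const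
      (-10 + 16 * s + 12 * s^2 - 18 * s^4)
    refine kconv this (fun y => ?_) ?_
    · simp [kN2]; ring
    · norm_num; ring
  have := kquot s x _ _ 2 hN hP
  refine kconv this (fun y => rfl) ?_
  · unfold kU3 kN3 kN2
    congr 1
    unfold kerrAdSP; push_cast; ring

lemma kU_ode (s x : ℝ) (hP : kerrAdSP s x ≠ 0) :
    kerrAdSα₁ s x * kU3 s x + kerrAdSα₂ s x * kU1 s x + kerrAdSα₃ s x * kU0 s x = 0 := by
  have key : kerrAdSα₁ s x * kN3 s x + kerrAdSα₂ s x * kN1 s x * kerrAdSP s x ^ 2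
      + kerrAdSα₃ s x * kN0 s x * kerrAdSP s x ^ 3 = 0 := by
    unfold kerrAdSα₁ kerrAdSα₂ kerrAdSα₃ kN3 kN1 kN0 kerrAdSP
    ring
  have : kerrAdSα₁ s x * kU3 s x + kerrAdSα₂ s x * kU1 s x + kerrAdSα₃ s x * kU0 s x
      = (kerrAdSα₁ s x * kN3 s x + kerrAdSα₂ s x * kN1 s x * kerrAdSP s x ^ 2
      + kerrAdSα₃ s x * kN0 s x * kerrAdSP s x ^ 3) / (4 * kerrAdSP s x ^ 4) := by
    unfold kU3 kU1 kU0
    field_simp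
  rw [this, key, zero_div]

lemma k_neg (s x : ℝ) (hs0 : 0 < s) (hs : s < 1/3) (hx : x ∈ Set.Ioo (-1 : ℝ) 1) :
    kerrAdSα₂ s x / kerrAdSα₁ s x * kU0 s x + 3 * kU2 s x < 0 := by
  have hP := kP_pos s x hs0 hs (Set.Ioo_subset_Icc_self hx)
  have h2 : 0 < 1 - x^2 := by nlinarith [hx.1, hx.2]
  have hT := kT_pos s x hs0 hs hx
  have : kerrAdSα₂ s x / kerrAdSα₁ s x * kU0 s x + 3 * kU2 s x
    = -(4 * (1 - 3 * s)^2 * (3 * s^2 * x^4 + s * (x^4 + 6 * x^2 - 1) + 2 * x^2 + 1)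
      * (4 - (1 + 3 * s)^2 * x^2) - 3 * (1 - x^2) * kN2 s x)
      / (4 * (1 - x^2) * kerrAdSP s x ^ 3) := by
    unfold kerrAdSα₂ kerrAdSα₁ kU0 kU2 kN0
    field_simp
    ring
  rw [this, neg_div]
  have : 0 < 4 * (1 - x^2) * kerrAdSP s x ^ 3 := by positivity
  have := div_pos hT this
  linarith

lemma k_core (a b X X1 X2 X3 U U1 U2 U3 : ℝ → ℝ)
    (hX : ∀ x ∈ Set.Ioo (-1 : ℝ) 1, HasDerivAt X (X1 x) x)
    (hX1 : ∀ x ∈ Set.Ioo (-1 : ℝ) 1, HasDerivAt X1 (X2 x) x)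
    (hX2 : ∀ x ∈ Set.Ioo (-1 : ℝ) 1, HasDerivAt X2 (X3 x) x)
    (hU : ∀ x ∈ Set.Ioo (-1 : ℝ) 1, HasDerivAt U (U1 x) x)
    (hU1 : ∀ x ∈ Set.Ioo (-1 : ℝ) 1, HasDerivAt U1 (U2 x) x)
    (hU2 : ∀ x ∈ Set.Ioo (-1 : ℝ) 1, HasDerivAt U2 (U3 x) x)
    (hXe : ∀ x ∈ Set.Ioo (-1 : ℝ) 1, X3 x = - a x * X1 x - b x * X x)
    (hUe : ∀ x ∈ Set.Ioo (-1 : ℝ) 1, U3 x = - a x * U1 x - b x * U x)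
    (hpos : ∀ x ∈ Set.Ioo (-1 : ℝ) 1, 0 < U x)
    (hneg : ∀ x ∈ Set.Ioo (-1 : ℝ) 1, a x * U x + 3 * U2 x < 0)
    (hlim : ∀ e : ℝ, e = -1 ∨ e = 1 → Filter.Tendsto (fun x =>
      (X1 x - X x / U x * U1 x) * (X2 x * U x - X x * U2 x)
        - 2 * (X1 x - X x / U x * U1 x)^2 * U1 x) (nhdsWithin e (Set.Ioo (-1 : ℝ) 1)) (nhds 0)) :
    ∃ c : ℝ, ∀ x ∈ Set.Ioo (-1 : ℝ) 1, X x = c * U x := by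
  set G : ℝ → ℝ := fun x => (X1 x - X x / U x * U1 x) * (X2 x * U x - X x * U2 x)
        - 2 * (X1 x - X x / U x * U1 x)^2 * U1 x with hG
  set W : ℝ → ℝ := fun x => X1 x * U x - X x * U1 x with hW
  set V : ℝ → ℝ := fun x => X2 x * U x - X x * U2 x with hV
  have hGd : ∀ x ∈ Set.Ioo (-1 : ℝ) 1, HasDerivAt G
      (1 / U x * (V x - 2 * W x * U1 x / U x)^2
        - (W x / U x)^2 * (a x * U x + 3 * U2 x)) x := by
    intro x hx
    have hne := (hpos x hx).ne'
    have hR := (hX1 x hx).sub (((hX x hx).div (hU x hx) hne).mul (hU1 x hx))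
    have hV' := ((hX2 x hx).mul (hU x hx)).sub ((hX x hx).mul (hU2 x hx))
    have := (hR.mul hV').sub (((hR.pow 2).const_mul 2).mul (hU1 x hx))
    refine kconv this (fun y => rfl) ?_
    simp only [hV, hW, Pi.sub_apply, Pi.mul_apply, Pi.div_apply, Pi.pow_apply]
    rw [hXe x hx, hUe x hx]
    push_cast
    field_simp
    ring
  have hGnn : ∀ x ∈ Set.Ioo (-1 : ℝ) 1, 0 ≤ (1 / U x * (V x - 2 * W x * U1 x / U x)^2
        - (W x / U x)^2 * (a x * U x + 3 * U2 x)) := by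
    intro x hx
    have h1 := hpos x hx
    have h2 := hneg x hx
    have h3 : 0 ≤ 1 / U x * (V x - 2 * W x * U1 x / U x)^2 := by positivity
    nlinarith [mul_nonneg (sq_nonneg (W x / U x)) (neg_nonneg.2 h2.le)]
  have hmono : MonotoneOn G (Set.Ioo (-1 : ℝ) 1) := by
    refine monotoneOn_of_deriv_nonneg (convex_Ioo _ _)
      (fun x hx => (hGd x hx).continuousAt.continuousWithinAt) ?_ ?_
    · rw [interior_Ioo]
      exact fun x hx => (hGd x hx).differentiableAt.differentiableWithinAt
    · rw [interior_Ioo]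
      intro x hx
      rw [(hGd x hx).deriv]
      exact hGnn x hx
  have hne1 : (nhdsWithin (1 : ℝ) (Set.Ioo (-1 : ℝ) 1)).NeBot :=
    mem_closure_iff_nhdsWithin_neBot.1 (by rw [closure_Ioo (by norm_num)]; simp)
  have hne2 : (nhdsWithin (-1 : ℝ) (Set.Ioo (-1 : ℝ) 1)).NeBot :=
    mem_closure_iff_nhdsWithin_neBot.1 (by rw [closure_Ioo (by norm_num)]; simp)
  have hG0 : ∀ x ∈ Set.Ioo (-1 : ℝ) 1, G x = 0 := by
    intro x hx
    apply le_antisymm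
    · refine ge_of_tendsto (hlim 1 (Or.inr rfl)) ?_
      filter_upwards [self_mem_nhdsWithin, mem_nhdsWithin_of_mem_nhds (lt_mem_nhds hx.2)]
        with y hy hxy
      exact hmono hx hy hxy.le
    · refine le_of_tendsto (hlim (-1) (Or.inl rfl)) ?_
      filter_upwards [self_mem_nhdsWithin, mem_nhdsWithin_of_mem_nhds (gt_mem_nhds hx.1)]
        with y hy hxy
      exact hmono hy hx hxy.le
  have hW0 : ∀ x ∈ Set.Ioo (-1 : ℝ) 1, W x = 0 := by
    intro x hx
    have hev : G =ᶠ[nhds x] fun _ => (0 : ℝ) := by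
      filter_upwards [isOpen_Ioo.mem_nhds hx] with y hy using hG0 y hy
    have h0 := ((hGd x hx).congr_of_eventuallyEq hev.symm).unique (hasDerivAt_const x (0 : ℝ))
    have h1 := hpos x hx
    have h2 := hneg x hx
    have h3 : 0 ≤ 1 / U x * (V x - 2 * W x * U1 x / U x)^2 := by positivity
    by_contra hne
    have h4 : 0 < (W x / U x)^2 := by positivity
    nlinarith [mul_pos h4 (neg_pos.2 h2)]
  have hQ : ∀ x ∈ Set.Ioo (-1 : ℝ) 1, HasDerivAt (fun y => X y / U y) 0 x := by
    intro x hx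
    have := (hX x hx).div (hU x hx) (hpos x hx).ne'
    refine kconv this (fun y => rfl) ?_
    have := hW0 x hx
    simp only [hW] at this
    rw [this, zero_div]
  refine ⟨X 0 / U 0, fun x hx => ?_⟩
  have := isOpen_Ioo.is_const_of_deriv_eq_zero (isPreconnected_Ioo)
    (fun y hy => (hQ y hy).differentiableAt.differentiableWithinAt)
    (fun y hy => (hQ y hy).deriv) hx (y := 0) (by norm_num)
  rw [← this, div_mul_cancel₀ _ (hpos x hx).ne']

lemma k_lim (e : ℝ) (X X1 X2 U U1 U2 : ℝ → ℝ) (he : e = -1 ∨ e = 1)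
    (hX : HasDerivWithinAt X (X1 e) (Set.Icc (-1 : ℝ) 1) e)
    (hU : HasDerivWithinAt U (U1 e) (Set.Icc (-1 : ℝ) 1) e)
    (cX1 : ContinuousWithinAt X1 (Set.Icc (-1 : ℝ) 1) e)
    (cX2 : ContinuousWithinAt X2 (Set.Icc (-1 : ℝ) 1) e)
    (cU1 : ContinuousWithinAt U1 (Set.Icc (-1 : ℝ) 1) e)
    (cU2 : ContinuousWithinAt U2 (Set.Icc (-1 : ℝ) 1) e)
    (hX0 : X e = 0) (hU0 : U e = 0) (hne : U1 e ≠ 0) :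
    Filter.Tendsto (fun x =>
      (X1 x - X x / U x * U1 x) * (X2 x * U x - X x * U2 x)
        - 2 * (X1 x - X x / U x * U1 x)^2 * U1 x)
      (nhdsWithin e (Set.Ioo (-1 : ℝ) 1)) (nhds 0) := by
  have hsub : Set.Ioo (-1 : ℝ) 1 ⊆ Set.Icc (-1 : ℝ) 1 := Set.Ioo_subset_Icc_self
  have hn : e ∉ Set.Ioo (-1 : ℝ) 1 := by rcases he with rfl | rfl <;> simp
  have sX := (hasDerivWithinAt_iff_tendsto_slope' hn).1 (hX.mono hsub)
  have sU := (hasDerivWithinAt_iff_tendsto_slope' hn).1 (hU.mono hsub)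
  have tX : Filter.Tendsto X _ _ := (hX.mono hsub).continuousWithinAt
  have tU : Filter.Tendsto U _ _ := (hU.mono hsub).continuousWithinAt
  have t1 : Filter.Tendsto X1 _ _ := cX1.mono hsub
  have t2 : Filter.Tendsto X2 _ _ := cX2.mono hsub
  have v1 : Filter.Tendsto U1 _ _ := cU1.mono hsub
  have v2 : Filter.Tendsto U2 _ _ := cU2.mono hsub
  have hq : Filter.Tendsto (fun x => X x / U x) (nhdsWithin e (Set.Ioo (-1 : ℝ) 1))
      (nhds (X1 e / U1 e)) := by
    refine (sX.div sU hne).congr' ?_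
    filter_upwards [self_mem_nhdsWithin] with y hy
    have hye : y - e ≠ 0 := by
      intro h
      exact hn (by rwa [← sub_eq_zero.1 h])
    simp only [Pi.div_apply, slope_def_field, hX0, hU0, sub_zero]
    exact div_div_div_cancel_right₀ hye _ _
  have hr := t1.sub (hq.mul v1)
  have := (hr.mul ((t2.mul tU).sub (tX.mul v2))).sub (((hr.pow 2).const_mul 2).mul v1)
  convert this using 2
  rw [hX0, hU0]
  field_simp
  ring

theorem kerrAdS_deformation_uniqueness (s : ℝ) (hs0 : 0 < s) (hs : s < 1/3)
    (X : ℝ → ℝ) (hX : ContDiffOn ℝ (⊤ : ℕ∞) X (Set.Icc (-1 : ℝ) 1))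
    (hODE : ∀ x ∈ Set.Ioo (-1 : ℝ) 1,
      kerrAdSα₁ s x * iteratedDeriv 3 X x + kerrAdSα₂ s x * deriv X x
        + kerrAdSα₃ s x * X x = 0) :
    ∃ c : ℝ, ∀ x ∈ Set.Ioo (-1 : ℝ) 1, X x = c * kerrAdSX₀ s x := by
  have hu : UniqueDiffOn ℝ (Set.Icc (-1 : ℝ) 1) := uniqueDiffOn_Icc (by norm_num)
  set D : ℕ → ℝ → ℝ := fun k => iteratedDerivWithin k X (Set.Icc (-1 : ℝ) 1) with hD
  have hDc : ∀ k, ContinuousOn (D k) (Set.Icc (-1 : ℝ) 1) := fun k =>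
    hX.continuousOn_iteratedDerivWithin (by exact_mod_cast le_top) hu
  have hDd : ∀ k, ∀ x ∈ Set.Icc (-1 : ℝ) 1,
      HasDerivWithinAt (D k) (D (k + 1) x) (Set.Icc (-1 : ℝ) 1) x := by
    intro k x hx
    have h := (hX.differentiableOn_iteratedDerivWithin (m := k)
      (by exact_mod_cast ENat.natCast_lt_top k) hu x hx).hasDerivWithinAt
    rw [← iteratedDerivWithin_succ] at h
    exact h
  have hDi : ∀ k, ∀ x ∈ Set.Ioo (-1 : ℝ) 1, HasDerivAt (D k) (D (k + 1) x) x := fun k x hx =>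
    (hDd k x (Set.Ioo_subset_Icc_self hx)).hasDerivAt (Icc_mem_nhds hx.1 hx.2)
  have hD0 : D 0 = X := by simp [hD]
  have hDk : ∀ k, ∀ x ∈ Set.Ioo (-1 : ℝ) 1, iteratedDeriv k X x = D k x := by
    intro k
    induction k with
    | zero => intro x hx; simp [hD0]
    | succ k ih =>
      intro x hx
      rw [iteratedDeriv_succ]
      have hev : iteratedDeriv k X =ᶠ[nhds x] D k := by
        filter_upwards [isOpen_Ioo.mem_nhds hx] with y hy using ih y hy
      rw [hev.deriv_eq]
      exact (hDi k x hx).deriv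
  have hE : ∀ x ∈ Set.Ioo (-1 : ℝ) 1,
      kerrAdSα₁ s x * D 3 x + kerrAdSα₂ s x * D 1 x + kerrAdSα₃ s x * D 0 x = 0 := by
    intro x hx
    have h := hODE x hx
    rw [← iteratedDeriv_one, hDk 3 x hx, hDk 1 x hx] at h
    rw [hD0]
    exact h
  have hem : ∀ e : ℝ, e = -1 ∨ e = 1 → e ∈ Set.Icc (-1 : ℝ) 1 := by
    rintro e (rfl | rfl) <;> simp
  have hX0 : ∀ e : ℝ, e = -1 ∨ e = 1 → D 0 e = 0 := by
    intro e he
    have hcont : ContinuousOn (fun x => kerrAdSα₁ s x * D 3 x + kerrAdSα₂ s x * D 1 x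
        + kerrAdSα₃ s x * D 0 x) (Set.Icc (-1 : ℝ) 1) := by
      have c1 : Continuous (kerrAdSα₁ s) := by unfold kerrAdSα₁ kerrAdSP; fun_prop
      have c2 : Continuous (kerrAdSα₂ s) := by unfold kerrAdSα₂ kerrAdSP; fun_prop
      have c3 : Continuous (kerrAdSα₃ s) := by unfold kerrAdSα₃; fun_prop
      exact ((c1.continuousOn.mul (hDc 3)).add (c2.continuousOn.mul (hDc 1))).add
        (c3.continuousOn.mul (hDc 0))
    have ht : Filter.Tendsto _ _ _ := ((hcont e (hem e he)).mono Set.Ioo_subset_Icc_self)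
    have hne : (nhdsWithin e (Set.Ioo (-1 : ℝ) 1)).NeBot :=
      mem_closure_iff_nhdsWithin_neBot.1
        (by rw [closure_Ioo (by norm_num)]; exact hem e he)
    have h0 := tendsto_nhds_unique (ht.congr' (f₂ := fun _ => (0 : ℝ)) (by
      filter_upwards [self_mem_nhdsWithin] with y hy using hE y hy)) tendsto_const_nhds
    have he2 : e^2 = 1 := by rcases he with rfl | rfl <;> norm_num
    have hene : e ≠ 0 := by rintro rfl; norm_num at he2
    have a1 : kerrAdSα₁ s e = 0 := by simp [kerrAdSα₁, he2]
    have a2 : kerrAdSα₂ s e = 0 := by simp [kerrAdSα₂, he2]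
    have a3 : kerrAdSα₃ s e = -24 * e * (1 - 3 * s)^3 * (1 + s)^3 := by
      have h4 : e^4 = 1 := by rw [show e^4 = (e^2)^2 by ring, he2]; norm_num
      have h6 : e^6 = 1 := by rw [show e^6 = (e^2)^3 by ring, he2]; norm_num
      unfold kerrAdSα₃
      rw [h4, h6, he2]
      ring
    beta_reduce at h0
    rw [a1, a2, a3, zero_mul, zero_mul, zero_add, zero_add] at h0
    have h3 : -24 * e * (1 - 3 * s)^3 * (1 + s)^3 ≠ 0 := by
      have : 1 - 3 * s ≠ 0 := by linarith
      have : 1 + s ≠ 0 := by linarith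
      positivity
    exact (mul_eq_zero.1 h0).resolve_left h3
  have hPne : ∀ x ∈ Set.Icc (-1 : ℝ) 1, kerrAdSP s x ≠ 0 := fun x hx =>
    (kP_pos s x hs0 hs hx).ne'
  have hI : ∀ x ∈ Set.Ioo (-1 : ℝ) 1, kerrAdSP s x ≠ 0 := fun x hx =>
    hPne x (Set.Ioo_subset_Icc_self hx)
  have ha1 : ∀ x ∈ Set.Ioo (-1 : ℝ) 1, kerrAdSα₁ s x ≠ 0 := by
    intro x hx
    have h2 : 1 - x^2 ≠ 0 := by nlinarith [hx.1, hx.2]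
    exact mul_ne_zero (pow_ne_zero _ h2) (pow_ne_zero _ (hI x hx))
  have hmain := k_core (fun x => kerrAdSα₂ s x / kerrAdSα₁ s x)
    (fun x => kerrAdSα₃ s x / kerrAdSα₁ s x) (D 0) (D 1) (D 2) (D 3)
    (kU0 s) (kU1 s) (kU2 s) (kU3 s) (hDi 0) (hDi 1) (hDi 2)
    (fun x hx => kU0_deriv s x (hI x hx)) (fun x hx => kU1_deriv s x (hI x hx))
    (fun x hx => kU2_deriv s x (hI x hx))
    (fun x hx => by
      have h := hE x hx
      have h1 := ha1 x hx
      field_simp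
      linarith)
    (fun x hx => by
      have h := kU_ode s x (hI x hx)
      have h1 := ha1 x hx
      field_simp
      linarith)
    (fun x hx => kU0_pos s x hs0 hs hx)
    (fun x hx => k_neg s x hs0 hs hx)
    (fun e he => by
      have hm := hem e he
      have hp := hPne e hm
      have he2 : e^2 = 1 := by rcases he with rfl | rfl <;> norm_num
      have hene : e ≠ 0 := by rintro rfl; norm_num at he2
      refine k_lim e _ _ _ _ _ _ he (hDd 0 e hm) (kU0_deriv s e hp).hasDerivWithinAt
        (hDc 1 e hm) (hDc 2 e hm) (kU1_deriv s e hp).continuousAt.continuousWithinAt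
        (kU2_deriv s e hp).continuousAt.continuousWithinAt (hX0 e he) ?_ ?_
      · simp [kU0, kN0, he2]
      · have hn : kN1 s e = -2 * e * (4 - (1 + 3 * s)^2 * e^2) * ((1 - 3 * s) * (1 + s)) := by
          have h3 : e^3 = e := by rw [show e^3 = e^2 * e by ring, he2, one_mul]
          have h5 : e^5 = e := by rw [show e^5 = (e^2)^2 * e by ring, he2]; ring
          unfold kN1
          rw [h3, h5, he2]
          ring
        have h1 := (kF_pos s e hs0 hs hm).ne'
        have h2 : 1 - 3 * s ≠ 0 := by linarith
        have h3 : 1 + s ≠ 0 := by linarith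
        unfold kU1
        rw [hn]
        positivity)
  obtain ⟨c, hc⟩ := hmain
  refine ⟨c, fun x hx => ?_⟩
  rw [← hD0]
  exact hc x hx
end
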